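/- arXiv:1005.3286 — 2 statements merged into one kernel-verified Lean document; each statement's English description precedes it below -/
import Mathlib

section
/- Let J = [α, β] be a compact interval with α < β, let U ⊆ ℝ² be an open neighbourhood of J × {0}, and let G : U → ℝ² be a C^∞ map such that G(τ, 0) = (τ, 0) for every τ ∈ J and such that for each τ ∈ J the derivative DG(τ, 0) is the linear map (σ, v) ↦ (σ + b(τ)v, r v), where r is a constant with 0 < r < 1 and b : J → ℝ is continuous. Then there exist an open neighbourhood U′ ⊆ U of (α, β) × {0} and, for each τ ∈ (α, β), a subset W^s_τ of U′ containing (τ, 0) such that: (i) W^s_τ is the image of a C¹ embedding of an open interval, passing through (τ, 0) with tangent direction (−b(τ), 1 − r) there; (ii) G(W^s_τ ∩ G⁻¹(U′)) ⊆ W^s_τ; (iii) W^s_τ = { u ∈ U′ : Gⁿ(u) is defined and lies in U′ for all n ≥ 0, and Gⁿ(u) → (τ, 0) as n → ∞ }; (iv) the curves W^s_τ foliate U′ continuously, i.e. there is a homeomorphism Φ : (α, β) × (−1, 1) → U′ with Φ(τ, 0) = (τ, 0) and Φ({τ} × (−1, 1)) = W^s_τ for each τ ∈ (α, β). -/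
open Set Filter Topology

/-- Distance from `t` to the boundary of `[α, β]`, for `t` in the interval. -/
noncomputable def boundaryDist (α β t : ℝ) : ℝ := min (t - α) (β - t)

/-- The open rhombus over `(α, β)` whose vertical half-width at `t` is `c * boundaryDist α β t`. -/
def openRhombus (α β c : ℝ) : Set (ℝ × ℝ) := {u | |u.2| < c * boundaryDist α β u.1}

theorem continuous_boundaryDist (α β : ℝ) : Continuous (boundaryDist α β) := by
  unfold boundaryDist; fun_prop

theorem isOpen_openRhombus (α β c : ℝ) : IsOpen (openRhombus α β c) :=
  isOpen_lt (by fun_prop) (continuous_const.mul ((continuous_boundaryDist α β).comp continuous_fst))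

theorem boundaryDist_pos {α β t : ℝ} : 0 < boundaryDist α β t ↔ t ∈ Ioo α β := by
  simp [boundaryDist]

theorem mem_Ioo_of_mem_openRhombus {α β c : ℝ} (hc : 0 < c) {u : ℝ × ℝ}
    (hu : u ∈ openRhombus α β c) : u.1 ∈ Ioo α β :=
  boundaryDist_pos.1 (pos_of_mul_pos_right ((abs_nonneg _).trans_lt hu) hc.le)

theorem mem_openRhombus_iff {α β c : ℝ} (hc : 0 < c) {u : ℝ × ℝ} :
    u ∈ openRhombus α β c ↔ |u.2| < c * (u.1 - α) ∧ |u.2| < c * (β - u.1) := by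
  rw [openRhombus, mem_ofPred_eq, boundaryDist, mul_min_of_nonneg _ _ hc.le, lt_min_iff]

theorem convex_openRhombus {α β c : ℝ} (hc : 0 < c) : Convex ℝ (openRhombus α β c) := by
  have habs : ConvexOn ℝ univ (fun u : ℝ × ℝ => |u.2|) :=
    (convexOn_norm (E := ℝ) convex_univ).comp_linearMap (LinearMap.snd ℝ ℝ ℝ)
  intro u hu v hv s t hs ht hst
  rw [mem_openRhombus_iff hc] at *
  have h := habs.2 (mem_univ u) (mem_univ v) hs ht hst
  simp only [smul_eq_mul, Prod.fst_add, Prod.smul_fst, Prod.snd_add, Prod.smul_snd] at h ⊢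
  have key : ∀ A B : ℝ, |u.2| < A → |v.2| < B → s * |u.2| + t * |v.2| < s * A + t * B := by
    intro A B hA hB
    rcases hs.eq_or_lt with rfl | hs'
    · have : t = 1 := by linarith
      subst this; simpa using hB
    · have := mul_lt_mul_of_pos_left hA hs'
      have := mul_le_mul_of_nonneg_left hB.le ht
      linarith
  constructor
  · refine h.trans_lt ((key _ _ hu.1 hv.1).trans_eq ?_)
    linear_combination (-c * α) * hst
  · refine h.trans_lt ((key _ _ hu.2 hv.2).trans_eq ?_)
    linear_combination (c * β) * hst

theorem sub_abs_le_boundaryDist (α β s t : ℝ) :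
    boundaryDist α β s - |t - s| ≤ boundaryDist α β t := by
  have h₁ : boundaryDist α β s ≤ s - α := min_le_left _ _
  have h₂ : boundaryDist α β s ≤ β - s := min_le_right _ _
  have h₃ := abs_le.1 (le_refl |t - s|)
  exact le_min (by linarith [h₃.1]) (by linarith [h₃.2])

theorem strictMonoOn_slice_of_fderiv_pos {D : Set (ℝ × ℝ)} (hD : IsOpen D) (hconv : Convex ℝ D)
    {π : ℝ × ℝ → ℝ} (hπ : ContDiffOn ℝ 1 π D) (hpos : ∀ u ∈ D, 0 < fderiv ℝ π u (1, 0)) (y : ℝ) :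
    StrictMonoOn (fun x => π (x, y)) {x | (x, y) ∈ D} := by
  have hder : ∀ x ∈ {x | (x, y) ∈ D},
      HasDerivAt (fun x => π (x, y)) (fderiv ℝ π (x, y) (1, 0)) x := fun x hx =>
    (((hπ.differentiableOn one_ne_zero).differentiableAt
      (hD.mem_nhds hx)).hasFDerivAt.comp_hasDerivAt x
        ((hasDerivAt_id x).prodMk (hasDerivAt_const x y)))
  have hslice : Convex ℝ {x : ℝ | (x, y) ∈ D} := by
    intro u hu v hv s t hs ht hst
    have := hconv hu hv hs ht hst
    simp only [Prod.smul_mk, Prod.mk_add_mk] at this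
    rwa [← add_smul, hst, one_smul] at this
  refine strictMonoOn_of_deriv_pos hslice (fun x hx => (hder x hx).continuousAt.continuousWithinAt)
    fun x hx => ?_
  have hxD : x ∈ {x | (x, y) ∈ D} := interior_subset hx
  rw [(hder x hxD).deriv]
  exact hpos _ hxD

/-- The shear `(σ, v) ↦ (ℓ (σ, v), v)` is invertible as soon as `ℓ (1, 0) ≠ 0`. -/
theorem exists_equiv_prod_snd (l : ℝ × ℝ →L[ℝ] ℝ) (hl : l (1, 0) ≠ 0) :
    ∃ e : (ℝ × ℝ) ≃L[ℝ] ℝ × ℝ,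
      (e : ℝ × ℝ →L[ℝ] ℝ × ℝ) = l.prod (ContinuousLinearMap.snd ℝ ℝ ℝ) := by
  have hdec : ∀ p : ℝ × ℝ, l p = p.1 * l (1, 0) + p.2 * l (0, 1) := by
    intro p
    conv_lhs => rw [show p = p.1 • ((1, 0) : ℝ × ℝ) + p.2 • ((0, 1) : ℝ × ℝ) by simp]
    rw [map_add, map_smul, map_smul, smul_eq_mul, smul_eq_mul]
  refine ⟨ContinuousLinearEquiv.equivOfInverse (l.prod (ContinuousLinearMap.snd ℝ ℝ ℝ))
    (((l (1, 0))⁻¹ • (ContinuousLinearMap.fst ℝ ℝ ℝ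
      - l (0, 1) • ContinuousLinearMap.snd ℝ ℝ ℝ)).prod (ContinuousLinearMap.snd ℝ ℝ ℝ)) ?_ ?_, rfl⟩
  · intro p
    ext <;> simp [hdec p]
    field_simp
    ring
  · intro p
    ext <;> simp [hdec ((l (1, 0))⁻¹ * (p.1 - l (0, 1) * p.2), p.2)]
    field_simp
    ring

/-- Solving `π (x, y) = τ` for `x` in a rhombus. -/
theorem exists_contDiffOn_solution {α β c K : ℝ} (hc : 0 < c) (hK : 0 ≤ K) {π : ℝ × ℝ → ℝ}
    (hπ : ContDiffOn ℝ 1 π (openRhombus α β c))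
    (hpos : ∀ u ∈ openRhombus α β c, 0 < fderiv ℝ π u (1, 0))
    (hclose : ∀ u ∈ openRhombus α β c, |π u - u.1| ≤ K * |u.2|) :
    ∃ ε > 0, ∃ h : ℝ × ℝ → ℝ, ContDiffOn ℝ 1 h (openRhombus α β ε) ∧
      ∀ p ∈ openRhombus α β ε, (h p, p.2) ∈ openRhombus α β c ∧ π (h p, p.2) = p.1 ∧
        ∀ x, (x, p.2) ∈ openRhombus α β c → π (x, p.2) = p.1 → x = h p := by
  have hopen := isOpen_openRhombus α β c
  have hden : 0 < 1 + c * K := by positivity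
  set ε := c / (1 + c * K) with hε
  have hε0 : 0 < ε := by positivity
  have hex : ∀ p ∈ openRhombus α β ε, ∃ x, (x, p.2) ∈ openRhombus α β c ∧ π (x, p.2) = p.1 := by
    intro p hp
    have hp' : |p.2| * (1 + c * K) < c * boundaryDist α β p.1 := by
      have := mul_lt_mul_of_pos_right (show |p.2| < ε * boundaryDist α β p.1 from hp) hden
      rwa [hε, div_mul_eq_mul_div, div_mul_cancel₀ _ hden.ne'] at this
    have hKy : 0 ≤ K * |p.2| := by positivity
    have hmem : ∀ x ∈ Icc (p.1 - K * |p.2|) (p.1 + K * |p.2|), (x, p.2) ∈ openRhombus α β c := by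
      intro x hx
      have h₁ : |x - p.1| ≤ K * |p.2| := abs_le.2 ⟨by linarith [hx.1], by linarith [hx.2]⟩
      have h₂ := mul_le_mul_of_nonneg_left (sub_abs_le_boundaryDist α β p.1 x) hc.le
      have h₃ := mul_le_mul_of_nonneg_left h₁ hc.le
      change |p.2| < c * boundaryDist α β x
      linarith
    have hle : p.1 - K * |p.2| ≤ p.1 + K * |p.2| := by linarith
    have hcont : ContinuousOn (fun x => π (x, p.2)) (Icc (p.1 - K * |p.2|) (p.1 + K * |p.2|)) :=
      hπ.continuousOn.comp (by fun_prop) hmem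
    have hl := abs_le.1 (hclose _ (hmem _ (left_mem_Icc.2 hle)))
    have hr := abs_le.1 (hclose _ (hmem _ (right_mem_Icc.2 hle)))
    dsimp only at hl hr
    obtain ⟨x, hx, hxe⟩ := intermediate_value_Icc hle hcont
      (show p.1 ∈ _ from ⟨by linarith [hl.2], by linarith [hr.1]⟩)
    exact ⟨x, hmem x hx, hxe⟩
  choose! h hhD hhπ using hex
  have huniq : ∀ p ∈ openRhombus α β ε, ∀ x, (x, p.2) ∈ openRhombus α β c →
      π (x, p.2) = p.1 → x = h p := fun p hp x hx hxe =>
    (strictMonoOn_slice_of_fderiv_pos hopen (convex_openRhombus hc) hπ hpos p.2).injOn hx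
      (hhD p hp) (hxe.trans (hhπ p hp).symm)
  refine ⟨ε, hε0, h, fun p hp => ContDiffAt.contDiffWithinAt ?_,
    fun p hp => ⟨hhD p hp, hhπ p hp, huniq p hp⟩⟩
  have hu := hhD p hp
  have hπu : ContDiffAt ℝ 1 π (h p, p.2) := hπ.contDiffAt (hopen.mem_nhds hu)
  obtain ⟨e, he⟩ := exists_equiv_prod_snd _ (hpos _ hu).ne'
  have hF : ContDiffAt ℝ 1 (fun u : ℝ × ℝ => (π u, u.2)) (h p, p.2) := hπu.prodMk contDiffAt_snd
  have hF' : HasFDerivAt (fun u : ℝ × ℝ => (π u, u.2)) (e : ℝ × ℝ →L[ℝ] ℝ × ℝ) (h p, p.2) := by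
    rw [he]
    exact (hπu.differentiableAt one_ne_zero).hasFDerivAt.prodMk hasFDerivAt_snd
  have hs := hF.hasStrictFDerivAt' hF' one_ne_zero
  have hFp : (π (h p, p.2), p.2) = p := by rw [hhπ p hp]
  have hg := hF.to_localInverse hF' one_ne_zero
  have hright := hs.eventually_right_inverse
  have himage := hs.localInverse_apply_image
  have hgdef : hF.localInverse hF' one_ne_zero = hs.localInverse _ _ _ := rfl
  rw [hgdef] at hg
  dsimp only at hg hright himage
  rw [hFp] at hg hright himage
  refine (contDiffAt_fst.comp p hg).congr_of_eventuallyEq ?_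
  have hmem : ∀ᶠ z in 𝓝 p, hs.localInverse _ _ _ z ∈ openRhombus α β c :=
    hg.continuousAt.eventually_mem (by rw [himage]; exact hopen.mem_nhds hu)
  filter_upwards [hright, hmem, (isOpen_openRhombus α β ε).mem_nhds hp] with z hz hzm hzE
  obtain ⟨h₁, h₂⟩ := Prod.ext_iff.1 hz
  dsimp only at h₁ h₂
  refine (huniq z hzE _ ?_ ?_).symm
  · rw [← h₂]; exact hzm
  · rw [← h₂]; exact h₁

/-- On a rhombus over `(α, β)` that `G` contracts towards the axis, the limit of `p ∘ Gⁿ` exists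
and is `C¹`, provided that `p` is invariant under `G` to second order along the axis. -/
theorem exists_limit_projection {α β ρ η C k : ℝ} (hαβ : α < β) (hρ : 0 < ρ) (hη0 : 0 < η)
    (hη1 : η < 1) (hC : 0 ≤ C) (hk : 1 ≤ k) (hsmall : C * (1 + k) * ρ ≤ η ^ 2 / 4)
    {V : Set (ℝ × ℝ)} (hV : IsOpen V) (hKV : Icc α β ×ˢ Icc (-ρ) ρ ⊆ V)
    {G : ℝ × ℝ → ℝ × ℝ} (hG : ContDiffOn ℝ 1 G V) {p : ℝ × ℝ → ℝ} (hp : ContDiffOn ℝ 1 p V)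
    (hq : ContDiffOn ℝ 1 (fun u => p (G u) - p u) V)
    (hG1 : ∀ u ∈ Icc α β ×ˢ Icc (-ρ) ρ, |(G u).1 - u.1| ≤ C * |u.2|)
    (hG2 : ∀ u ∈ Icc α β ×ˢ Icc (-ρ) ρ, |(G u).2| ≤ (1 - η) * |u.2|)
    (hDG : ∀ u ∈ Icc α β ×ˢ Icc (-ρ) ρ, ∀ v,
      |(fderiv ℝ G u v).1| + k * |(fderiv ℝ G u v).2| ≤ (1 + η) * (|v.1| + k * |v.2|))
    (hDq : ∀ u ∈ Icc α β ×ˢ Icc (-ρ) ρ, ‖fderiv ℝ (fun u => p (G u) - p u) u‖ ≤ C * |u.2|)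
    (hpu : ∀ u ∈ Icc α β ×ˢ Icc (-ρ) ρ, |p u - u.1| ≤ C * |u.2|)
    (hDp : ∀ u ∈ Icc α β ×ˢ Icc (-ρ) ρ, ‖fderiv ℝ p u‖ ≤ C)
    (hDp1 : ∀ u ∈ Icc α β ×ˢ Icc (-ρ) ρ, |fderiv ℝ p u (1, 0) - 1| ≤ 1 / 4) :
    ∃ c > 0, ∃ K ≥ 0, ∃ π : ℝ × ℝ → ℝ,
      openRhombus α β c ⊆ V ∧
      MapsTo G (openRhombus α β c) (openRhombus α β c) ∧
      (∀ u ∈ openRhombus α β c, |(G u).2| ≤ |u.2|) ∧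
      (∀ u ∈ openRhombus α β c, Tendsto (fun n => G^[n] u) atTop (𝓝 (π u, 0))) ∧
      ContDiffOn ℝ 1 π (openRhombus α β c) ∧
      (∀ u ∈ openRhombus α β c, 0 < fderiv ℝ π u (1, 0)) ∧
      (∀ u ∈ openRhombus α β c, |π u - u.1| ≤ K * |u.2|) ∧
      ∀ τ ∈ Ioo α β, fderiv ℝ π (τ, 0) = fderiv ℝ p (τ, 0) := by
  set q : ℝ × ℝ → ℝ := fun u => p (G u) - p u with hqdef
  set c := min (ρ / (β - α)) (η / (C + 1)) with hcdef
  have hc : 0 < c := lt_min (div_pos hρ (by linarith)) (by positivity)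
  have hcρ : c * (β - α) ≤ ρ := (le_div_iff₀ (by linarith)).1 (min_le_left _ _)
  have hcC : c * (C + 1) ≤ η := (le_div_iff₀ (by linarith)).1 (min_le_right _ _)
  set D := openRhombus α β c with hDdef
  have hDopen : IsOpen D := isOpen_openRhombus α β c
  have hDconv : Convex ℝ D := convex_openRhombus hc
  have hDρ : ∀ u ∈ D, |u.2| ≤ ρ := by
    intro u hu
    have h₁ := mem_Ioo_of_mem_openRhombus hc hu
    have h₂ : |u.2| < c * boundaryDist α β u.1 := hu
    have h₃ : boundaryDist α β u.1 ≤ β - α := (min_le_left _ _).trans (by linarith [h₁.2])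
    nlinarith
  have hDK : D ⊆ Icc α β ×ˢ Icc (-ρ) ρ := fun u hu =>
    ⟨Ioo_subset_Icc_self (mem_Ioo_of_mem_openRhombus hc hu), abs_le.1 (hDρ u hu)⟩
  have hDV : D ⊆ V := hDK.trans hKV
  have haxis : ∀ τ ∈ Ioo α β, (τ, (0 : ℝ)) ∈ D := fun τ hτ => by
    change |(0 : ℝ)| < c * boundaryDist α β τ
    rw [abs_zero]
    exact mul_pos hc (boundaryDist_pos.2 hτ)
  have haxis' : ∀ u ∈ D, (u.1, (0 : ℝ)) ∈ D := fun u hu =>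
    haxis _ (mem_Ioo_of_mem_openRhombus hc hu)
  have hmaps : MapsTo G D D := by
    intro u hu
    have h₁ : |u.2| < c * boundaryDist α β u.1 := hu
    have h₂ := mul_le_mul_of_nonneg_left (sub_abs_le_boundaryDist α β u.1 (G u).1) hc.le
    have h₃ := mul_le_mul_of_nonneg_left (hG1 u (hDK hu)) hc.le
    have h₄ := hG2 u (hDK hu)
    have h₅ : c * C ≤ η := by nlinarith
    have h₆ := mul_le_mul_of_nonneg_right h₅ (abs_nonneg u.2)
    change |(G u).2| < c * boundaryDist α β (G u).1
    linarith
  have hiter : ∀ n, MapsTo G^[n] D D := fun n => hmaps.iterate n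
  have hsnd : ∀ n, ∀ u ∈ D, |(G^[n] u).2| ≤ (1 - η) ^ n * |u.2| := by
    intro n u hu
    induction n with
    | zero => simp
    | succ n ih =>
      rw [Function.iterate_succ_apply', pow_succ', mul_assoc]
      exact (hG2 _ (hDK (hiter n hu))).trans (mul_le_mul_of_nonneg_left ih (by linarith))
  have hfixed : ∀ τ ∈ Ioo α β, G (τ, 0) = (τ, 0) := by
    intro τ hτ
    have h₁ := hG1 _ (hDK (haxis τ hτ))
    have h₂ := hG2 _ (hDK (haxis τ hτ))
    simp only [abs_zero, mul_zero, abs_nonpos_iff, sub_eq_zero] at h₁ h₂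
    exact Prod.ext h₁ h₂
  have hfixed' : ∀ τ ∈ Ioo α β, ∀ n, G^[n] (τ, 0) = (τ, 0) := fun τ hτ n =>
    Function.iterate_fixed (hfixed τ hτ) n
  have hGdiff : ∀ u ∈ D, DifferentiableAt ℝ G u := fun u hu =>
    (hG.differentiableOn one_ne_zero).differentiableAt (hV.mem_nhds (hDV hu))
  have hqdiff : ∀ u ∈ D, DifferentiableAt ℝ q u := fun u hu =>
    (hq.differentiableOn one_ne_zero).differentiableAt (hV.mem_nhds (hDV hu))
  have hitersmooth : ∀ n, ContDiffOn ℝ 1 G^[n] D := by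
    intro n
    induction n with
    | zero => exact contDiffOn_id
    | succ n ih =>
      rw [Function.iterate_succ']
      exact (hG.mono hDV).comp ih (hiter n)
  have hiterdiff : ∀ n, ∀ u ∈ D, DifferentiableAt ℝ G^[n] u := fun n u hu =>
    ((hitersmooth n).differentiableOn one_ne_zero).differentiableAt (hDopen.mem_nhds hu)
  have hiterfderiv : ∀ n, ∀ u ∈ D, ∀ v,
      |(fderiv ℝ G^[n] u v).1| + k * |(fderiv ℝ G^[n] u v).2|
        ≤ (1 + η) ^ n * (|v.1| + k * |v.2|) := by
    intro n u hu v
    induction n with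
    | zero => simp
    | succ n ih =>
      rw [Function.iterate_succ', fderiv_comp _ (hGdiff _ (hiter n hu)) (hiterdiff n u hu),
        pow_succ', mul_assoc]
      exact (hDG _ (hDK (hiter n hu)) _).trans (mul_le_mul_of_nonneg_left ih (by linarith))
  have hiternorm : ∀ n, ∀ u ∈ D, ‖fderiv ℝ G^[n] u‖ ≤ (1 + η) ^ n * (1 + k) := by
    intro n u hu
    refine ContinuousLinearMap.opNorm_le_bound _ (by positivity) fun v => ?_
    have h₁ := hiterfderiv n u hu v
    set w := fderiv ℝ G^[n] u v
    have h₂ : ‖w‖ ≤ |w.1| + k * |w.2| := by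
      rw [Prod.norm_def, Real.norm_eq_abs, Real.norm_eq_abs]
      exact max_le (by nlinarith [abs_nonneg w.1, abs_nonneg w.2])
        (by nlinarith [abs_nonneg w.1, abs_nonneg w.2])
    have h₃ : |v.1| ≤ ‖v‖ := norm_fst_le v
    have h₄ : |v.2| ≤ ‖v‖ := norm_snd_le v
    have h₅ : |v.1| + k * |v.2| ≤ (1 + k) * ‖v‖ := by nlinarith
    rw [mul_assoc]
    exact h₂.trans (h₁.trans (mul_le_mul_of_nonneg_left h₅ (by positivity)))
  have hμ0 : 0 ≤ 1 - η ^ 2 := by nlinarith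
  have hμ1 : 1 - η ^ 2 < 1 := by nlinarith
  set f : ℕ → ℝ × ℝ → ℝ := fun n => q ∘ G^[n] with hf
  have hfsmooth : ∀ n, ContDiffOn ℝ 1 (f n) D := fun n =>
    (hq.mono hDV).comp (hitersmooth n) (hiter n)
  have hfdiff : ∀ n, ∀ u ∈ D, HasFDerivAt (f n) (fderiv ℝ (f n) u) u := fun n u hu =>
    (((hfsmooth n).differentiableOn one_ne_zero).differentiableAt (hDopen.mem_nhds hu)).hasFDerivAt
  have hfnorm : ∀ n, ∀ u ∈ D, ‖fderiv ℝ (f n) u‖ ≤ C * (1 + k) * |u.2| * (1 - η ^ 2) ^ n := by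
    intro n u hu
    rw [hf, fderiv_comp _ (hqdiff _ (hiter n hu)) (hiterdiff n u hu)]
    calc _ ≤ ‖fderiv ℝ q (G^[n] u)‖ * ‖fderiv ℝ G^[n] u‖ := ContinuousLinearMap.opNorm_comp_le _ _
      _ ≤ (C * ((1 - η) ^ n * |u.2|)) * ((1 + η) ^ n * (1 + k)) := by
          refine mul_le_mul ?_ (hiternorm n u hu) (norm_nonneg _) ?_
          · exact (hDq _ (hDK (hiter n hu))).trans (mul_le_mul_of_nonneg_left (hsnd n u hu) hC)
          · have : 0 ≤ 1 - η := by linarith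
            positivity
      _ = C * (1 + k) * |u.2| * ((1 - η) ^ n * (1 + η) ^ n) := by ring
      _ = _ := by rw [← mul_pow]; ring
  have hfunif : ∀ n, ∀ u ∈ D, ‖fderiv ℝ (f n) u‖ ≤ C * (1 + k) * ρ * (1 - η ^ 2) ^ n :=
    fun n u hu => (hfnorm n u hu).trans (by gcongr; exact hDρ u hu)
  have hgeom : Summable fun n => C * (1 + k) * ρ * (1 - η ^ 2) ^ n :=
    (summable_geometric_of_lt_one hμ0 hμ1).mul_left _
  have hmid : (α + β) / 2 ∈ Ioo α β := ⟨by linarith, by linarith⟩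
  have hfaxis : ∀ τ ∈ Ioo α β, ∀ n, f n (τ, 0) = 0 := fun τ hτ n => by
    simp [hf, hqdef, hfixed' τ hτ n, hfixed τ hτ]
  have hsum0 : Summable fun n => f n ((α + β) / 2, 0) := by
    simp only [hfaxis _ hmid]
    exact summable_zero
  have hsum : ∀ u ∈ D, Summable fun n => f n u := fun u hu =>
    summable_of_summable_hasFDerivAt_of_isPreconnected hgeom hDopen hDconv.isPreconnected hfdiff
      hfunif (haxis _ hmid) hsum0 hu
  set π : ℝ × ℝ → ℝ := fun u => p u + ∑' n, f n u with hπdef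
  have hpdiff : ∀ u ∈ D, HasFDerivAt p (fderiv ℝ p u) u := fun u hu =>
    ((hp.differentiableOn one_ne_zero).differentiableAt (hV.mem_nhds (hDV hu))).hasFDerivAt
  have hπdiff : ∀ u ∈ D, HasFDerivAt π (fderiv ℝ p u + ∑' n, fderiv ℝ (f n) u) u := fun u hu =>
    (hpdiff u hu).add (hasFDerivAt_tsum_of_isPreconnected hgeom hDopen hDconv.isPreconnected hfdiff
      hfunif (haxis _ hmid) hsum0 hu)
  have htail : ∀ u ∈ D, ‖∑' n, fderiv ℝ (f n) u‖ ≤ C * (1 + k) * |u.2| / η ^ 2 := by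
    intro u hu
    have h₁ := (hasSum_geometric_of_lt_one hμ0 hμ1).mul_left (C * (1 + k) * |u.2|)
    rw [sub_sub_cancel, ← div_eq_mul_inv] at h₁
    exact tsum_of_norm_bounded h₁ fun n => hfnorm n u hu
  have htail' : ∀ u ∈ D, ‖∑' n, fderiv ℝ (f n) u‖ ≤ 1 / 4 := by
    intro u hu
    refine (htail u hu).trans ?_
    rw [div_le_iff₀ (by positivity)]
    have : C * (1 + k) * |u.2| ≤ C * (1 + k) * ρ := by gcongr; exact hDρ u hu
    linarith
  have hπaxis : ∀ τ ∈ Ioo α β, π (τ, 0) = τ := by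
    intro τ hτ
    have h₁ := hpu _ (hDK (haxis τ hτ))
    simp only [abs_zero, mul_zero, abs_nonpos_iff, sub_eq_zero] at h₁
    simp [hπdef, h₁, hfaxis τ hτ]
  refine ⟨c, hc, C + 1 / 4, by positivity, π, hDV, hmaps, fun u hu => ?_, fun u hu => ?_, ?_,
    fun u hu => ?_, fun u hu => ?_, fun τ hτ => ?_⟩
  · have h₁ := hG2 u (hDK hu)
    nlinarith [abs_nonneg u.2]
  · have hpow : Tendsto (fun n : ℕ => (1 - η) ^ n * |u.2|) atTop (𝓝 0) := by
      simpa using (tendsto_pow_atTop_nhds_zero_of_lt_one (by linarith : 0 ≤ 1 - η)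
        (by linarith)).mul_const |u.2|
    have h₂ : Tendsto (fun n => (G^[n] u).2) atTop (𝓝 0) :=
      squeeze_zero_norm (fun n => hsnd n u hu) hpow
    have h₃ : Tendsto (fun n => p (G^[n] u)) atTop (𝓝 (π u)) := by
      have h := (hsum u hu).hasSum.tendsto_sum_nat.const_add (p u)
      refine h.congr fun n => ?_
      have : ∀ i, f i u = p (G^[i + 1] u) - p (G^[i] u) := fun i => by
        rw [Function.iterate_succ_apply']; rfl
      simp only [this, Finset.sum_range_sub (fun i => p (G^[i] u))]
      simp
    have h₄ : Tendsto (fun n => p (G^[n] u) - (G^[n] u).1) atTop (𝓝 0) := by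
      have h := hpow.const_mul C
      rw [mul_zero] at h
      exact squeeze_zero_norm (fun n => (hpu _ (hDK (hiter n hu))).trans
        (mul_le_mul_of_nonneg_left (hsnd n u hu) hC)) h
    have h₅ := h₃.sub h₄
    simp only [sub_sub_cancel, sub_zero] at h₅
    exact h₅.prodMk_nhds h₂
  · have hcont : ContinuousOn (fderiv ℝ π) D := by
      have h₁ : ContinuousOn (fun u => fderiv ℝ p u + ∑' n, fderiv ℝ (f n) u) D :=
        ((hp.mono hDV).continuousOn_fderiv_of_isOpen hDopen le_rfl).add
          (continuousOn_tsum (fun n => (hfsmooth n).continuousOn_fderiv_of_isOpen hDopen le_rfl)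
            hgeom hfunif)
      exact h₁.congr fun u hu => (hπdiff u hu).fderiv
    rw [show (1 : WithTop ℕ∞) = 0 + 1 by simp, contDiffOn_succ_iff_fderiv_of_isOpen hDopen]
    exact ⟨fun u hu => (hπdiff u hu).differentiableAt.differentiableWithinAt, by simp,
      contDiffOn_zero.2 hcont⟩
  · rw [(hπdiff u hu).fderiv, add_apply]
    have h₁ := (abs_le.1 (hDp1 u (hDK hu))).1
    have h₂ := (∑' n, fderiv ℝ (f n) u).le_opNorm (1, 0)
    have h₃ : ‖((1, 0) : ℝ × ℝ)‖ = 1 := by simp [Prod.norm_def]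
    rw [h₃, mul_one, Real.norm_eq_abs] at h₂
    have h₄ := (abs_le.1 (h₂.trans (htail' u hu))).1
    linarith
  · have h₁ := hDconv.norm_image_sub_le_of_norm_hasFDerivWithin_le (C := C + 1 / 4)
      (fun x hx => (hπdiff x hx).hasFDerivWithinAt)
      (fun x hx => (norm_add_le _ _).trans (add_le_add (hDp x (hDK hx)) (htail' x hx)))
      (haxis' u hu) hu
    rw [hπaxis _ (mem_Ioo_of_mem_openRhombus hc hu)] at h₁
    have h₂ : u - (u.1, 0) = (0, u.2) := by ext <;> simp
    rw [h₂] at h₁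
    simpa [Prod.norm_def] using h₁
  · rw [(hπdiff _ (haxis τ hτ)).fderiv]
    have h₁ := htail _ (haxis τ hτ)
    simp only [abs_zero, mul_zero, zero_div, norm_le_zero_iff] at h₁
    rw [h₁, add_zero]

/-- A `C¹` function is bounded on a compact rectangle, and Lipschitz along vertical segments. -/
theorem exists_bound_and_vertical_lipschitz {E : Type*} [NormedAddCommGroup E] [NormedSpace ℝ E]
    {α β ρ : ℝ} {V : Set (ℝ × ℝ)} (hV : IsOpen V) (hKV : Icc α β ×ˢ Icc (-ρ) ρ ⊆ V)
    {f : ℝ × ℝ → E} (hf : ContDiffOn ℝ 1 f V) :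
    ∃ C ≥ 0, ∀ u ∈ Icc α β ×ˢ Icc (-ρ) ρ, ‖f u‖ ≤ C ∧ ‖f u - f (u.1, 0)‖ ≤ C * |u.2| := by
  have hcompact : IsCompact (Icc α β ×ˢ Icc (-ρ) ρ) := isCompact_Icc.prod isCompact_Icc
  have hconv : Convex ℝ (Icc α β ×ˢ Icc (-ρ) ρ) := (convex_Icc α β).prod (convex_Icc (-ρ) ρ)
  obtain ⟨C₁, hC₁⟩ := hcompact.exists_bound_of_continuousOn (hf.continuousOn.mono hKV)
  obtain ⟨C₂, hC₂⟩ := hcompact.exists_bound_of_continuousOn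
    ((hf.continuousOn_fderiv_of_isOpen hV le_rfl).mono hKV)
  refine ⟨max 0 (max C₁ C₂), le_max_left _ _, fun u hu => ⟨(hC₁ u hu).trans (by simp), ?_⟩⟩
  have hu0 : (u.1, (0 : ℝ)) ∈ Icc α β ×ˢ Icc (-ρ) ρ := by
    have := hu.2
    exact ⟨hu.1, by linarith [this.1, this.2], by linarith [this.1, this.2]⟩
  have h₁ := hconv.norm_image_sub_le_of_norm_fderiv_le (𝕜 := ℝ)
    (fun x hx => (hf.differentiableOn one_ne_zero).differentiableAt (hV.mem_nhds (hKV hx)))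
    hC₂ hu0 hu
  have h₂ : u - (u.1, 0) = (0, u.2) := by ext <;> simp
  have h₃ : ‖((0, u.2) : ℝ × ℝ)‖ = |u.2| := by simp [Prod.norm_def]
  rw [h₂, h₃] at h₁
  exact h₁.trans (mul_le_mul_of_nonneg_right (by simp) (abs_nonneg _))

/-- An open neighbourhood of `[α, β] × {0}` contains a rectangle around it. -/
theorem exists_rectangle_subset {α β : ℝ} {V : Set (ℝ × ℝ)} (hV : IsOpen V)
    (hJV : Icc α β ×ˢ ({0} : Set ℝ) ⊆ V) : ∃ ρ > 0, Icc α β ×ˢ Icc (-ρ) ρ ⊆ V := by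
  obtain ⟨A, B, -, hB, hA, h0, hAB⟩ :=
    generalized_tube_lemma isCompact_Icc isCompact_singleton hV hJV
  obtain ⟨ρ, hρ, hball⟩ := Metric.nhds_basis_closedBall.mem_iff.1
    (hB.mem_nhds (singleton_subset_iff.1 h0))
  rw [Real.closedBall_eq_Icc, zero_sub, zero_add] at hball
  exact ⟨ρ, hρ, (prod_mono hA hball).trans hAB⟩

/-- The first-order data along the axis give a forward-invariant rhombus on which `Gⁿ` converges
to a `C¹` projection onto the axis. -/
theorem exists_stable_projection {α β r : ℝ} (hαβ : α < β) (hr0 : 0 < r) (hr1 : r < 1)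
    {U : Set (ℝ × ℝ)} (hUopen : IsOpen U) (hJU : Icc α β ×ˢ ({0} : Set ℝ) ⊆ U)
    {G : ℝ × ℝ → ℝ × ℝ} (hG : ContDiffOn ℝ (⊤ : ℕ∞) G U) {b : ℝ → ℝ}
    (hfix : ∀ τ ∈ Icc α β, G (τ, 0) = (τ, 0))
    (hD : ∀ τ ∈ Icc α β, ∀ p, fderiv ℝ G (τ, 0) p = (p.1 + b τ * p.2, r * p.2)) :
    ∃ c > 0, ∃ K ≥ 0, ∃ π : ℝ × ℝ → ℝ,
      openRhombus α β c ⊆ U ∧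
      MapsTo G (openRhombus α β c) (openRhombus α β c) ∧
      (∀ u ∈ openRhombus α β c, |(G u).2| ≤ |u.2|) ∧
      (∀ u ∈ openRhombus α β c, Tendsto (fun n => G^[n] u) atTop (𝓝 (π u, 0))) ∧
      ContDiffOn ℝ 1 π (openRhombus α β c) ∧
      (∀ u ∈ openRhombus α β c, 0 < fderiv ℝ π u (1, 0)) ∧
      (∀ u ∈ openRhombus α β c, |π u - u.1| ≤ K * |u.2|) ∧
      ∀ τ ∈ Ioo α β, ∀ p : ℝ × ℝ, fderiv ℝ π (τ, 0) p = p.1 + b τ / (1 - r) * p.2 := by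
  have hr : 0 < 1 - r := by linarith
  set B : ℝ → ℝ := fun x => (fderiv ℝ G (x, 0) (0, 1)).1 with hB
  set p : ℝ × ℝ → ℝ := fun u => u.1 + B u.1 / (1 - r) * u.2 with hpdef
  set q : ℝ × ℝ → ℝ := fun u => p (G u) - p u with hqdef
  have hBJ : ∀ τ ∈ Icc α β, B τ = b τ := fun τ hτ => by simp [hB, hD τ hτ]
  have hDGsmooth : ContDiffOn ℝ 2 (fderiv ℝ G) U :=
    (contDiffOn_infty.1 hG 3).fderiv_of_isOpen hUopen (by norm_num)
  have hBsmooth : ContDiffOn ℝ 2 B {x | (x, (0 : ℝ)) ∈ U} :=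
    contDiff_fst.comp_contDiffOn ((hDGsmooth.comp (t := U)
      (contDiff_id.prodMk contDiff_const).contDiffOn fun x hx => hx).clm_apply contDiffOn_const)
  set V₁ : Set (ℝ × ℝ) := U ∩ {u | (u.1, (0 : ℝ)) ∈ U} with hV₁
  have hV₁open : IsOpen V₁ := hUopen.inter (hUopen.preimage (by fun_prop))
  have hpsmooth : ContDiffOn ℝ 2 p V₁ :=
    contDiffOn_fst.add (((hBsmooth.comp contDiffOn_fst fun u hu => hu.2).div_const _).mul
      contDiffOn_snd)
  set V : Set (ℝ × ℝ) := V₁ ∩ G ⁻¹' V₁ with hV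
  have hVV₁ : V ⊆ V₁ := inter_subset_left
  have hVU : V ⊆ U := hVV₁.trans inter_subset_left
  have hVopen : IsOpen V :=
    (hG.continuousOn.mono inter_subset_left).isOpen_inter_preimage hV₁open hV₁open
  have hJV₁ : ∀ τ ∈ Icc α β, (τ, (0 : ℝ)) ∈ V₁ := fun τ hτ =>
    ⟨hJU ⟨hτ, rfl⟩, hJU ⟨hτ, rfl⟩⟩
  have hJV : ∀ τ ∈ Icc α β, (τ, (0 : ℝ)) ∈ V := fun τ hτ =>
    ⟨hJV₁ τ hτ, by rw [mem_preimage, hfix τ hτ]; exact hJV₁ τ hτ⟩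
  have hGV : ContDiffOn ℝ 2 G V := (contDiffOn_infty.1 hG 2).mono hVU
  have hqsmooth : ContDiffOn ℝ 2 q V :=
    (hpsmooth.comp hGV fun u hu => hu.2).sub (hpsmooth.mono hVV₁)
  have hpV : ContDiffOn ℝ 2 p V := hpsmooth.mono hVV₁
  have hGdiff : ∀ u ∈ V, DifferentiableAt ℝ G u := fun u hu =>
    (hGV.differentiableOn two_ne_zero).differentiableAt (hVopen.mem_nhds hu)
  have hpdiff : ∀ u ∈ V₁, DifferentiableAt ℝ p u := fun u hu =>
    (hpsmooth.differentiableOn two_ne_zero).differentiableAt (hV₁open.mem_nhds hu)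
  have hDp : ∀ τ ∈ Icc α β, ∀ v : ℝ × ℝ, fderiv ℝ p (τ, 0) v = v.1 + b τ / (1 - r) * v.2 := by
    intro τ hτ v
    have hBd : DifferentiableAt ℝ B τ :=
      (hBsmooth.differentiableOn two_ne_zero).differentiableAt
        ((hUopen.preimage (by fun_prop : Continuous fun x : ℝ => (x, (0 : ℝ)))).mem_nhds
          (hJU ⟨hτ, rfl⟩))
    have h₁ : HasFDerivAt (fun u : ℝ × ℝ => B u.1 / (1 - r))
        (((1 - r)⁻¹ * deriv B τ) • ContinuousLinearMap.fst ℝ ℝ ℝ) (τ, (0 : ℝ)) := by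
      have h := (hBd.hasDerivAt.const_mul (1 - r)⁻¹).comp_hasFDerivAt (τ, (0 : ℝ))
        (hasFDerivAt_fst (𝕜 := ℝ) (E := ℝ) (F := ℝ))
      refine h.congr_of_eventuallyEq (Eventually.of_forall fun u => ?_)
      simp [div_eq_inv_mul]
    have h₂ := (hasFDerivAt_fst (𝕜 := ℝ) (p := (τ, (0 : ℝ)))).add
      (h₁.mul (hasFDerivAt_snd (𝕜 := ℝ) (p := (τ, (0 : ℝ)))))
    have h₃ : HasFDerivAt p _ (τ, (0 : ℝ)) := h₂
    rw [h₃.fderiv]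
    simp [hBJ τ hτ]
  have hDq : ∀ τ ∈ Icc α β, fderiv ℝ q (τ, 0) = 0 := by
    intro τ hτ
    have h₁ : HasFDerivAt p (fderiv ℝ p (τ, 0)) (G (τ, 0)) := by
      rw [hfix τ hτ]; exact (hpdiff _ (hJV₁ τ hτ)).hasFDerivAt
    have h₂ : HasFDerivAt q _ (τ, (0 : ℝ)) :=
      (h₁.comp (τ, (0 : ℝ)) (hGdiff _ (hJV τ hτ)).hasFDerivAt).sub
        (hpdiff _ (hJV₁ τ hτ)).hasFDerivAt
    rw [h₂.fderiv]
    refine ContinuousLinearMap.ext fun v => ?_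
    simp [hDp τ hτ, hD τ hτ]
    field_simp
    ring
  obtain ⟨ρ₀, hρ₀, hKV₀⟩ := exists_rectangle_subset hVopen (α := α) (β := β) (by
    rintro ⟨τ, y⟩ ⟨hτ, rfl⟩
    exact hJV τ hτ)
  have hsmoothAll : ContDiffOn ℝ 1
      (fun u => ((G u, p u), fderiv ℝ G u, fderiv ℝ p u, fderiv ℝ q u)) V :=
    ((hGV.of_le one_le_two).prodMk (hpV.of_le one_le_two)).prodMk
      (((hDGsmooth.mono hVU).of_le one_le_two).prodMk
        ((hpV.fderiv_of_isOpen hVopen (by norm_num)).prodMk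
          (hqsmooth.fderiv_of_isOpen hVopen (by norm_num))))
  obtain ⟨C, hC, hall⟩ := exists_bound_and_vertical_lipschitz hVopen hKV₀ hsmoothAll
  simp only [Prod.mk_sub_mk, Prod.norm_mk, max_le_iff] at hall
  set η := (1 - r) / 2 with hη
  set k := 1 + C / (1 - r) with hk
  have hk1 : 1 ≤ k := by rw [hk]; linarith [div_nonneg hC hr.le]
  have hkC : k * (1 - r) = (1 - r) + C := by rw [hk]; field_simp
  have hη0 : 0 < η := half_pos hr
  have hη1 : η < 1 / 2 := by linarith
  have hCk : 0 ≤ C * (1 + k) := by positivity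
  set ρ := min ρ₀ (η ^ 2 / 4 / (C * (1 + k) + 1)) with hρdef
  have hρ : 0 < ρ := lt_min hρ₀ (by positivity)
  have hsmall : C * (1 + k) * ρ ≤ η ^ 2 / 4 := by
    have h₁ := (le_div_iff₀ (by positivity)).1 (min_le_right ρ₀ (η ^ 2 / 4 / (C * (1 + k) + 1)))
    rw [← hρdef] at h₁
    nlinarith
  have hsmall' : C * ρ ≤ η ^ 2 / 4 := by
    have : 0 ≤ C * ρ := by positivity
    nlinarith
  set K : Set (ℝ × ℝ) := Icc α β ×ˢ Icc (-ρ) ρ with hKdef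
  have hKK₀ : K ⊆ Icc α β ×ˢ Icc (-ρ₀) ρ₀ := by
    have : ρ ≤ ρ₀ := min_le_left _ _
    exact prod_mono le_rfl (Icc_subset_Icc (by linarith) this)
  have hKV : K ⊆ V := hKK₀.trans hKV₀
  have hKconv : Convex ℝ K := (convex_Icc α β).prod (convex_Icc (-ρ) ρ)
  have hKaxis : ∀ u ∈ K, (u.1, (0 : ℝ)) ∈ K := fun u hu =>
    ⟨hu.1, by simp [hρ.le], hρ.le⟩
  have hKρ : ∀ u ∈ K, C * |u.2| ≤ C * ρ := fun u hu =>
    mul_le_mul_of_nonneg_left (abs_le.2 hu.2) hC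
  have hpaxis : ∀ x : ℝ, p (x, 0) = x := fun x => by simp [hpdef]
  have hG1 : ∀ u ∈ K, |(G u).1 - u.1| ≤ C * |u.2| := by
    intro u hu
    have h := (hall u (hKK₀ hu)).2.1.1
    rw [hfix _ hu.1] at h
    exact (norm_fst_le _).trans h
  have hG2 : ∀ u ∈ K, |(G u).2| ≤ (1 - η) * |u.2| := by
    intro u hu
    set g : ℝ × ℝ → ℝ := fun u => (G u).2 - r * u.2 with hg
    have hgd : ∀ x ∈ K, HasFDerivAt g ((ContinuousLinearMap.snd ℝ ℝ ℝ).comp (fderiv ℝ G x)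
        - r • ContinuousLinearMap.snd ℝ ℝ ℝ) x := fun x hx =>
      (hasFDerivAt_snd.comp x (hGdiff x (hKV hx)).hasFDerivAt).sub (hasFDerivAt_snd.const_mul r)
    have hgn : ∀ x ∈ K, ‖(ContinuousLinearMap.snd ℝ ℝ ℝ).comp (fderiv ℝ G x)
        - r • ContinuousLinearMap.snd ℝ ℝ ℝ‖ ≤ η := by
      intro x hx
      have h := (hall x (hKK₀ hx)).2.2.1
      refine ContinuousLinearMap.opNorm_le_bound _ hη0.le fun v => ?_
      have h' : ((ContinuousLinearMap.snd ℝ ℝ ℝ).comp (fderiv ℝ G x)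
          - r • ContinuousLinearMap.snd ℝ ℝ ℝ) v
          = ((fderiv ℝ G x - fderiv ℝ G (x.1, 0)) v).2 := by
        simp [hD _ hx.1]
      rw [h']
      refine (norm_snd_le _).trans ((ContinuousLinearMap.le_of_opNorm_le _ h v).trans ?_)
      have := hKρ x hx
      exact mul_le_mul_of_nonneg_right (by nlinarith) (norm_nonneg _)
    have h := hKconv.norm_image_sub_le_of_norm_hasFDerivWithin_le
      (fun x hx => (hgd x hx).hasFDerivWithinAt) hgn (hKaxis u hu) hu
    have hu' : u - (u.1, 0) = (0, u.2) := by ext <;> simp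
    have hn : ‖((0, u.2) : ℝ × ℝ)‖ = |u.2| := by simp [Prod.norm_def]
    have hg0 : g (u.1, 0) = 0 := by simp [hg, hfix _ hu.1]
    rw [hu', hn, hg0, sub_zero, Real.norm_eq_abs] at h
    have habs : |(G u).2| ≤ |g u| + r * |u.2| := by
      have : (G u).2 = g u + r * u.2 := by simp [hg]
      rw [this]
      refine (abs_add_le _ _).trans_eq ?_
      rw [abs_mul, abs_of_pos hr0]
    have : r = 1 - 2 * η := by rw [hη]; ring
    rw [this] at habs
    linarith
  have hDG : ∀ u ∈ K, ∀ v,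
      |(fderiv ℝ G u v).1| + k * |(fderiv ℝ G u v).2| ≤ (1 + η) * (|v.1| + k * |v.2|) := by
    intro u hu v
    have h := (hall u (hKK₀ hu)).2.2.1
    have hb : |b u.1| ≤ C := by
      have h' := ContinuousLinearMap.le_of_opNorm_le _ (hall _ (hKK₀ (hKaxis u hu))).1.2.1 (0, 1)
      rw [hD _ hu.1] at h'
      have hn : ‖((0, 1) : ℝ × ℝ)‖ = 1 := by simp [Prod.norm_def]
      rw [hn, mul_one] at h'
      simpa using (norm_fst_le _).trans h'
    set e := (fderiv ℝ G u - fderiv ℝ G (u.1, 0)) v with he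
    have hev : fderiv ℝ G u v = (v.1 + b u.1 * v.2 + e.1, r * v.2 + e.2) := by
      have : fderiv ℝ G u v = fderiv ℝ G (u.1, 0) v + e := by simp [he]
      rw [this, hD _ hu.1]
      rfl
    have hen : ‖e‖ ≤ C * ρ * ‖v‖ :=
      (ContinuousLinearMap.le_of_opNorm_le _ h v).trans
        (mul_le_mul_of_nonneg_right (hKρ u hu) (norm_nonneg _))
    have he1 : |e.1| ≤ C * ρ * ‖v‖ := (norm_fst_le _).trans hen
    have he2 : |e.2| ≤ C * ρ * ‖v‖ := (norm_snd_le _).trans hen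
    have hv : ‖v‖ ≤ |v.1| + k * |v.2| := by
      rw [Prod.norm_def, Real.norm_eq_abs, Real.norm_eq_abs]
      exact max_le (by nlinarith [abs_nonneg v.1, abs_nonneg v.2])
        (by nlinarith [abs_nonneg v.1, abs_nonneg v.2])
    have ha1 : |v.1 + b u.1 * v.2 + e.1| ≤ |v.1| + C * |v.2| + C * ρ * ‖v‖ := by
      refine (abs_add_three _ _ _).trans ?_
      rw [abs_mul]
      have := mul_le_mul_of_nonneg_right hb (abs_nonneg v.2)
      linarith
    have ha2 : |r * v.2 + e.2| ≤ r * |v.2| + C * ρ * ‖v‖ := by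
      refine (abs_add_le _ _).trans ?_
      rw [abs_mul, abs_of_pos hr0]
      linarith
    rw [hev]
    dsimp only
    have hs : C * (1 + k) * ρ * ‖v‖ ≤ η * (|v.1| + k * |v.2|) := by
      have : C * (1 + k) * ρ ≤ η := by nlinarith
      exact mul_le_mul this hv (norm_nonneg _) hη0.le
    have hk2 := mul_le_mul_of_nonneg_left ha2 (by linarith : 0 ≤ k)
    have hk3 : (C + k * r) * |v.2| ≤ k * |v.2| :=
      mul_le_mul_of_nonneg_right (by linarith) (abs_nonneg _)
    linarith
  have hDqK : ∀ u ∈ K, ‖fderiv ℝ q u‖ ≤ C * |u.2| := by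
    intro u hu
    have h := (hall u (hKK₀ hu)).2.2.2.2
    rwa [hDq _ hu.1, sub_zero] at h
  have hpK : ∀ u ∈ K, |p u - u.1| ≤ C * |u.2| := by
    intro u hu
    have h := (hall u (hKK₀ hu)).2.1.2
    rwa [hpaxis] at h
  have hDpK : ∀ u ∈ K, ‖fderiv ℝ p u‖ ≤ C := by
    intro u hu
    exact (hall u (hKK₀ hu)).1.2.2.1
  have hDp1 : ∀ u ∈ K, |fderiv ℝ p u (1, 0) - 1| ≤ 1 / 4 := by
    intro u hu
    have h := ContinuousLinearMap.le_of_opNorm_le _ (hall u (hKK₀ hu)).2.2.2.1 (1, 0)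
    have hn : ‖((1, 0) : ℝ × ℝ)‖ = 1 := by simp [Prod.norm_def]
    rw [hn, mul_one, sub_apply, hDp _ hu.1, Real.norm_eq_abs] at h
    simp only [mul_zero, add_zero] at h
    have := hKρ u hu
    nlinarith
  obtain ⟨c, hc, K', hK', π, hcV, h₁, h₂, h₃, h₄, h₅, h₆, h₇⟩ :=
    exists_limit_projection hαβ hρ hη0 (by linarith) hC hk1 hsmall hVopen hKV
      (hGV.of_le one_le_two) (hpV.of_le one_le_two) (hqsmooth.of_le one_le_two)
      hG1 hG2 hDG hDqK hpK hDpK hDp1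
  exact ⟨c, hc, K', hK', π, hcV.trans hVU, h₁, h₂, h₃, h₄, h₅, h₆, fun τ hτ v => by
    rw [h₇ τ hτ, hDp τ (Ioo_subset_Icc_self hτ)]⟩

/-- The map `s ↦ 2s / (1 + s²)`, bounded by `1`, restricts to a bijection of `(-1, 1)`. -/
theorem bijOn_two_mul_div_one_add_sq :
    BijOn (fun s : ℝ => 2 * s / (1 + s ^ 2)) (Ioo (-1) 1) (Ioo (-1) 1) := by
  refine ⟨fun s hs => ?_, fun s hs t ht hst => ?_, fun t ht => ?_⟩
  · have h : 0 < 1 + s ^ 2 := by positivity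
    constructor
    · rw [lt_div_iff₀ h]; nlinarith [hs.1]
    · rw [div_lt_iff₀ h]; nlinarith [hs.2]
  · have h : 0 < 1 + s ^ 2 := by positivity
    have h' : 0 < 1 + t ^ 2 := by positivity
    dsimp only at hst
    rw [div_eq_div_iff h.ne' h'.ne'] at hst
    have hprod : (s - t) * (1 - s * t) = 0 := by linarith
    have hne : 1 - s * t ≠ 0 := by
      have : |s| * |t| < 1 := by
        have h₁ := abs_lt.2 hs
        have h₂ := abs_lt.2 ht
        nlinarith [abs_nonneg s, abs_nonneg t]
      rw [← abs_mul] at this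
      linarith [le_abs_self (s * t)]
    linarith [(mul_eq_zero.1 hprod).resolve_right hne]
  · have hsq : 0 < 1 - t ^ 2 := by nlinarith [ht.1, ht.2]
    have hq := Real.sqrt_pos.2 hsq
    have hq2 := Real.sq_sqrt hsq.le
    set q := √(1 - t ^ 2)
    have h : 0 < 1 + q := by linarith
    refine ⟨t / (1 + q), ⟨?_, ?_⟩, ?_⟩
    · rw [lt_div_iff₀ h]; linarith [ht.1]
    · rw [div_lt_iff₀ h]; linarith [ht.2]
    · dsimp only
      have h₁ : 1 + (t / (1 + q)) ^ 2 = 2 / (1 + q) := by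
        field_simp
        linarith
      rw [h₁]
      field_simp

theorem abs_two_mul_div_one_add_sq_le_one (s : ℝ) : |2 * s / (1 + s ^ 2)| ≤ 1 := by
  have h : 0 < 1 + s ^ 2 := by positivity
  rw [abs_le]
  constructor
  · rw [le_div_iff₀ h]; nlinarith [sq_nonneg (s + 1)]
  · rw [div_le_iff₀ h]; nlinarith [sq_nonneg (s - 1)]

theorem hasDerivAt_two_mul_div_one_add_sq (s : ℝ) :
    HasDerivAt (fun s : ℝ => 2 * s / (1 + s ^ 2)) (2 * (1 - s ^ 2) / (1 + s ^ 2) ^ 2) s := by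
  have h : 1 + s ^ 2 ≠ 0 := by positivity
  refine (((hasDerivAt_id' s).const_mul 2).div ((hasDerivAt_pow 2 s).const_add 1) h).congr_deriv ?_
  simp only [Nat.cast_ofNat]
  ring

/-- **Nondegenerate chatter: continuous foliation by stable manifolds.**
Let `J = [α, β]` with `α < β`, let `U ⊆ ℝ²` be an open neighbourhood of `J × {0}`,
and let `G : U → ℝ²` be a `C^∞` map fixing every point `(τ, 0)` for `τ ∈ J`, whose
derivative at `(τ, 0)` is `(σ, v) ↦ (σ + b(τ)v, r v)` with `0 < r < 1` and `b`
continuous on `J`.  Then there are an open neighbourhood `U' ⊆ U` of `(α,β) × {0}`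
and, for each `τ ∈ (α, β)`, a local stable manifold `W τ ∋ (τ,0)`: a `C¹` embedded
curve through `(τ,0)` tangent there to `(−b(τ), 1−r)`, invariant under `G`, equal to
the set of points of `U'` whose forward `G`-orbit stays in `U'` and converges to
`(τ,0)`; moreover the curves `W τ` foliate `U'` continuously, via a homeomorphism
`Φ : (α,β) × (−1,1) → U'` with `Φ(τ,0) = (τ,0)` and `Φ({τ} × (−1,1)) = W τ`. -/
theorem nondegenerate_chatter_continuous_foliation
    (α β r : ℝ) (hαβ : α < β) (hr0 : 0 < r) (hr1 : r < 1)
    (U : Set (ℝ × ℝ)) (hUopen : IsOpen U)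
    (hJU : Set.Icc α β ×ˢ ({0} : Set ℝ) ⊆ U)
    (G : ℝ × ℝ → ℝ × ℝ) (hGsmooth : ContDiffOn ℝ (⊤ : ℕ∞) G U)
    (b : ℝ → ℝ) (hb : ContinuousOn b (Set.Icc α β))
    (hfix : ∀ τ ∈ Set.Icc α β, G (τ, 0) = (τ, 0))
    (L : ℝ → (ℝ × ℝ) →L[ℝ] ℝ × ℝ)
    (hLdef : ∀ τ : ℝ, ∀ p : ℝ × ℝ, L τ p = (p.1 + b τ * p.2, r * p.2))
    (hD : ∀ τ ∈ Set.Icc α β, HasFDerivAt G (L τ) ((τ, 0) : ℝ × ℝ)) :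
    ∃ U' : Set (ℝ × ℝ), IsOpen U' ∧ U' ⊆ U ∧
      Set.Ioo α β ×ˢ ({0} : Set ℝ) ⊆ U' ∧
      ∃ W : ℝ → Set (ℝ × ℝ),
        (∀ τ ∈ Set.Ioo α β,
          (τ, 0) ∈ W τ ∧ W τ ⊆ U' ∧
          -- (i) W τ is the image of a C¹ embedding of an open interval, passing
          -- through (τ,0) with tangent direction (−b(τ), 1 − r) there
          (∃ c : ℝ → ℝ × ℝ, ContDiff ℝ 1 c ∧
            Set.InjOn c (Set.Ioo (-1 : ℝ) 1) ∧
            (∀ s ∈ Set.Ioo (-1 : ℝ) 1, deriv c s ≠ 0) ∧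
            c '' Set.Ioo (-1 : ℝ) 1 = W τ ∧ c 0 = (τ, 0) ∧
            (∃ k : ℝ, k ≠ 0 ∧ deriv c 0 = k • ((-b τ, 1 - r) : ℝ × ℝ))) ∧
          -- (ii) invariance
          G '' (W τ ∩ G ⁻¹' U') ⊆ W τ ∧
          -- (iii) stable-manifold characterisation
          W τ = {u ∈ U' | (∀ n : ℕ, G^[n] u ∈ U') ∧
            Filter.Tendsto (fun n => G^[n] u) Filter.atTop (nhds ((τ, 0) : ℝ × ℝ))}) ∧
        -- (iv) continuous trivialisation Φ : (α,β) × (−1,1) → U'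
        ∃ Φ Ψ : ℝ × ℝ → ℝ × ℝ,
          ContinuousOn Φ (Set.Ioo α β ×ˢ Set.Ioo (-1 : ℝ) 1) ∧
          ContinuousOn Ψ U' ∧
          Set.BijOn Φ (Set.Ioo α β ×ˢ Set.Ioo (-1 : ℝ) 1) U' ∧
          Set.InvOn Ψ Φ (Set.Ioo α β ×ˢ Set.Ioo (-1 : ℝ) 1) U' ∧
          (∀ τ ∈ Set.Ioo α β, Φ (τ, 0) = (τ, 0)) ∧
          (∀ τ ∈ Set.Ioo α β, Φ '' ({τ} ×ˢ Set.Ioo (-1 : ℝ) 1) = W τ) := by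
  have hfd : ∀ τ ∈ Icc α β, ∀ p, fderiv ℝ G (τ, 0) p = (p.1 + b τ * p.2, r * p.2) :=
    fun τ hτ p => by rw [(hD τ hτ).fderiv, hLdef]
  obtain ⟨c, hc, K, hK, π, hRU, hmaps, hcontr, hlim, hπ, hpos, hclose, htan⟩ :=
    exists_stable_projection hαβ hr0 hr1 hUopen hJU hGsmooth hfix hfd
  obtain ⟨ε, hε, h, hh, hsol⟩ := exists_contDiffOn_solution hc hK hπ hpos hclose
  set R := openRhombus α β c with hR
  have hRopen : IsOpen R := isOpen_openRhombus α β c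
  have haxis : ∀ τ ∈ Ioo α β, (τ, (0 : ℝ)) ∈ R := fun τ hτ => by
    change |(0 : ℝ)| < c * boundaryDist α β τ
    rw [abs_zero]
    exact mul_pos hc (boundaryDist_pos.2 hτ)
  have hπaxis : ∀ τ ∈ Ioo α β, π (τ, 0) = τ := fun τ hτ => by
    have := hclose _ (haxis τ hτ)
    simpa [sub_eq_zero] using this
  have hinv : ∀ u ∈ R, π (G u) = π u := fun u hu => by
    have h₁ := (hlim u hu).comp (tendsto_add_atTop_nat 1)
    exact congrArg Prod.fst (tendsto_nhds_unique (hlim _ (hmaps hu)) h₁)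
  -- vertical half-length of the leaf through `(τ, 0)`
  set w : ℝ → ℝ := fun t => ε / 2 * boundaryDist α β t with hw
  have hwcont : Continuous w := continuous_const.mul (continuous_boundaryDist α β)
  have hwpos : ∀ τ ∈ Ioo α β, 0 < w τ := fun τ hτ =>
    mul_pos (half_pos hε) (boundaryDist_pos.2 hτ)
  have hmemE : ∀ τ ∈ Ioo α β, ∀ s : ℝ, |s| ≤ 1 → (τ, w τ * s) ∈ openRhombus α β ε := by
    intro τ hτ s hs
    change |w τ * s| < ε * boundaryDist α β τ
    have h₁ := hwpos τ hτ
    rw [abs_mul, abs_of_pos h₁]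
    have h₂ : ε * boundaryDist α β τ = 2 * w τ := by rw [hw]; ring
    nlinarith
  set U' : Set (ℝ × ℝ) := {u | u ∈ R ∧ |u.2| < w (π u)} with hU'
  have hU'R : U' ⊆ R := fun u hu => hu.1
  have hU'open : IsOpen U' := by
    have h₁ : ContinuousOn (fun u : ℝ × ℝ => w (π u) - |u.2|) R :=
      (hwcont.comp_continuousOn hπ.continuousOn).sub (by fun_prop)
    convert h₁.isOpen_inter_preimage hRopen (isOpen_Ioi (a := 0)) using 1
    ext u
    simp [hU']
  have hπU' : ∀ u ∈ U', π u ∈ Ioo α β := fun u hu =>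
    boundaryDist_pos.1 (pos_of_mul_pos_right ((abs_nonneg _).trans_lt hu.2) (half_pos hε).le)
  have hGU' : MapsTo G U' U' := fun u hu =>
    ⟨hmaps hu.1, by rw [hinv u hu.1]; exact (hcontr u hu.1).trans_lt hu.2⟩
  set Φ : ℝ × ℝ → ℝ × ℝ := fun p => (h (p.1, w p.1 * p.2), w p.1 * p.2) with hΦ
  set Ψ : ℝ × ℝ → ℝ × ℝ := fun u => (π u, u.2 / w (π u)) with hΨ
  have hπΦ : ∀ τ ∈ Ioo α β, ∀ s : ℝ, |s| ≤ 1 → π (Φ (τ, s)) = τ := fun τ hτ s hs =>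
    (hsol _ (hmemE τ hτ s hs)).2.1
  have hΦmaps : MapsTo Φ (Ioo α β ×ˢ Ioo (-1 : ℝ) 1) U' := by
    rintro ⟨τ, s⟩ ⟨hτ, hs⟩
    have hs' : |s| < 1 := abs_lt.2 hs
    refine ⟨(hsol _ (hmemE τ hτ s hs'.le)).1, ?_⟩
    rw [hπΦ τ hτ s hs'.le]
    have h₁ := hwpos τ hτ
    change |w τ * s| < w τ
    rw [abs_mul, abs_of_pos h₁]
    nlinarith
  have hΨmaps : MapsTo Ψ U' (Ioo α β ×ˢ Ioo (-1 : ℝ) 1) := by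
    intro u hu
    have h₁ := hwpos _ (hπU' u hu)
    refine ⟨hπU' u hu, abs_lt.1 ?_⟩
    change |u.2 / w (π u)| < 1
    rw [abs_div, abs_of_pos h₁, div_lt_one h₁]
    exact hu.2
  have hΨΦ : LeftInvOn Ψ Φ (Ioo α β ×ˢ Ioo (-1 : ℝ) 1) := by
    rintro ⟨τ, s⟩ ⟨hτ, hs⟩
    have h₁ := hπΦ τ hτ s (abs_lt.2 hs).le
    have h₂ := hwpos τ hτ
    change (π (Φ (τ, s)), w τ * s / w (π (Φ (τ, s)))) = (τ, s)
    rw [h₁, mul_div_cancel_left₀ _ h₂.ne']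
  have hΦΨ : RightInvOn Ψ Φ U' := by
    intro u hu
    have h₁ := hwpos _ (hπU' u hu)
    have h₂ : w (π u) * (u.2 / w (π u)) = u.2 := mul_div_cancel₀ _ h₁.ne'
    have h₃ := hmemE _ (hπU' u hu) _ (abs_lt.2 (hΨmaps hu).2).le
    change (h (π u, w (π u) * (u.2 / w (π u))), w (π u) * (u.2 / w (π u))) = u
    change (π u, w (π u) * (u.2 / w (π u))) ∈ _ at h₃
    rw [h₂] at h₃ ⊢
    rw [← (hsol _ h₃).2.2 u.1 hu.1 rfl]
  have hImage : ∀ τ ∈ Ioo α β, Φ '' ({τ} ×ˢ Ioo (-1 : ℝ) 1) = {u | u ∈ U' ∧ π u = τ} := by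
    intro τ hτ
    ext u
    constructor
    · rintro ⟨⟨t, s⟩, ⟨rfl, hs⟩, rfl⟩
      exact ⟨hΦmaps ⟨hτ, hs⟩, hπΦ _ hτ s (abs_lt.2 hs).le⟩
    · rintro ⟨hu, rfl⟩
      exact ⟨Ψ u, ⟨rfl, (hΨmaps hu).2⟩, hΦΨ hu⟩
  have hΦ0 : ∀ τ ∈ Ioo α β, Φ (τ, 0) = (τ, 0) := by
    intro τ hτ
    have h₁ := (hsol _ (hmemE τ hτ 0 (by simp))).2.2 τ
    rw [mul_zero] at h₁
    change (h (τ, w τ * 0), w τ * 0) = (τ, 0)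
    rw [mul_zero, ← h₁ (haxis τ hτ) (hπaxis τ hτ)]
  have hmem0 : ∀ τ ∈ Ioo α β, (τ, (0 : ℝ)) ∈ U' := fun τ hτ => by
    rw [← hΦ0 τ hτ]; exact hΦmaps ⟨hτ, by norm_num⟩
  refine ⟨U', hU'open, hU'R.trans hRU, ?_, fun τ => {u | u ∈ U' ∧ π u = τ}, ?_, Φ, Ψ, ?_, ?_,
    ⟨hΦmaps, hΨΦ.injOn, hΦΨ.surjOn hΨmaps⟩, ⟨hΨΦ, hΦΨ⟩, hΦ0, hImage⟩
  · rintro ⟨τ, y⟩ ⟨hτ, rfl⟩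
    exact hmem0 τ hτ
  · intro τ hτ
    refine ⟨⟨hmem0 τ hτ, hπaxis τ hτ⟩, fun u hu => hu.1, ?_, ?_, ?_⟩
    · set θ : ℝ → ℝ := fun s => 2 * s / (1 + s ^ 2) with hθ
      have hθsmooth : ContDiff ℝ 1 θ :=
        (contDiff_const.mul contDiff_id).div (contDiff_const.add (contDiff_id.pow 2))
          fun s => by positivity
      have hθ1 : ∀ s, |θ s| ≤ 1 := abs_two_mul_div_one_add_sq_le_one
      have hcurve : ContDiff ℝ 1 fun s => Φ (τ, θ s) := by
        have h₁ : ContDiff ℝ 1 fun s => (τ, w τ * θ s) :=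
          contDiff_const.prodMk (contDiff_const.mul hθsmooth)
        have h₂ : ContDiff ℝ 1 fun s => w τ * θ s := contDiff_const.mul hθsmooth
        refine ContDiff.prodMk ?_ h₂
        exact contDiff_iff_contDiffAt.2 fun s =>
          (hh.contDiffAt ((isOpen_openRhombus α β ε).mem_nhds (hmemE τ hτ _ (hθ1 s)))).comp s
            h₁.contDiffAt
      have hder : ∀ s, HasDerivAt (fun s => Φ (τ, θ s)) (deriv (fun s => Φ (τ, θ s)) s) s :=
        fun s => (hcurve.differentiable one_ne_zero s).hasDerivAt
      have hder2 : ∀ s, (deriv (fun s => Φ (τ, θ s)) s).2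
          = w τ * (2 * (1 - s ^ 2) / (1 + s ^ 2) ^ 2) := fun s => by
        have h₁ : HasDerivAt (fun s => (Φ (τ, θ s)).2) (deriv (fun s => Φ (τ, θ s)) s).2 s :=
          HasFDerivAt.comp_hasDerivAt (l' := ContinuousLinearMap.snd ℝ ℝ ℝ) s hasFDerivAt_snd (hder s)
        exact h₁.unique ((hasDerivAt_two_mul_div_one_add_sq s).const_mul (w τ))
      have hθ0 : θ 0 = 0 := by simp [hθ]
      have hcurve0 : Φ (τ, θ 0) = (τ, 0) := by rw [hθ0]; exact hΦ0 τ hτ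
      refine ⟨fun s => Φ (τ, θ s), hcurve, ?_, ?_, ?_, hcurve0, ?_⟩
      · intro s hs t ht hst
        have h₁ := hΨΦ.injOn ⟨hτ, bijOn_two_mul_div_one_add_sq.mapsTo hs⟩
          ⟨hτ, bijOn_two_mul_div_one_add_sq.mapsTo ht⟩ hst
        exact bijOn_two_mul_div_one_add_sq.injOn hs ht (congrArg Prod.snd h₁)
      · intro s hs h0
        have h₁ := hder2 s
        rw [h0] at h₁
        have h₂ : 0 < 1 - s ^ 2 := by nlinarith [hs.1, hs.2]
        have h₃ := hwpos τ hτ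
        have h₄ : 0 < w τ * (2 * (1 - s ^ 2) / (1 + s ^ 2) ^ 2) := by positivity
        exact h₄.ne h₁
      · have h₁ := hImage τ hτ
        rw [singleton_prod, image_image, ← bijOn_two_mul_div_one_add_sq.image_eq,
          image_image] at h₁
        exact h₁
      · have h₁ := hder2 0
        have h₂ : HasFDerivAt π (fderiv ℝ π (τ, 0)) (Φ (τ, θ 0)) := by
          rw [hcurve0]
          exact ((hπ.differentiableOn one_ne_zero).differentiableAt
            (hRopen.mem_nhds (haxis τ hτ))).hasFDerivAt
        have h₃ : HasDerivAt (fun s => π (Φ (τ, θ s))) 0 0 := by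
          simp only [fun s => hπΦ τ hτ (θ s) (hθ1 s)]
          exact hasDerivAt_const _ _
        have h₄ := (h₂.comp_hasDerivAt (0 : ℝ) (hder 0)).unique h₃
        rw [htan τ hτ] at h₄
        have h₅ := hwpos τ hτ
        have h₆ : 1 - r ≠ 0 := by linarith
        refine ⟨2 * w τ / (1 - r), by positivity, Prod.ext ?_ ?_⟩
        · simp only [Prod.smul_mk, smul_eq_mul]
          rw [eq_neg_of_add_eq_zero_left h₄, h₁]
          field_simp
          ring
        · simp only [Prod.smul_mk, smul_eq_mul]
          rw [h₁]
          field_simp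
          ring
    · rintro _ ⟨u, ⟨hu, -⟩, rfl⟩
      exact ⟨hGU' hu.1, (hinv u hu.1.1).trans hu.2⟩
    · ext u
      constructor
      · rintro ⟨hu, rfl⟩
        exact ⟨hu, fun n => hGU'.iterate n hu, hlim u hu.1⟩
      · rintro ⟨hu, -, hconv⟩
        exact ⟨hu, congrArg Prod.fst (tendsto_nhds_unique (hlim u hu.1) hconv)⟩
  · have h₁ : ContinuousOn (fun p : ℝ × ℝ => (p.1, w p.1 * p.2)) (Ioo α β ×ˢ Ioo (-1 : ℝ) 1) := by
      fun_prop
    exact (hh.continuousOn.comp h₁ fun p hp => hmemE _ hp.1 _ (abs_lt.2 hp.2).le).prodMk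
      (by fun_prop)
  · have h₁ := hπ.continuousOn.mono hU'R
    exact h₁.prodMk (continuousOn_snd.div (hwcont.comp_continuousOn h₁)
      fun u hu => (hwpos _ (hπU' u hu)).ne')
end

section
/- Let J = [α, β] be a compact interval with α < β, let U ⊆ ℝ² be an open neighbourhood of J × {0}, and let G : U → ℝ² be a C^∞ map such that G(τ, 0) = (τ, 0) for every τ ∈ J and such that for each τ ∈ J the derivative DG(τ, 0) is the linear map (σ, v) ↦ (σ + b(τ)v, r v), where 0 < r < 1 is constant and b : J → ℝ is continuous. Then the neighbourhood U′ and the stable-manifold foliation {W^s_τ}_{τ∈(α,β)} of the previous statement can be chosen so that the trivializing map Φ : (α, β) × (−1, 1) → U′, with Φ(τ, 0) = (τ, 0) and Φ({τ} × (−1, 1)) = W^s_τ, is a C^∞ diffeomorphism; in particular the stable manifolds W^s_τ form a smooth foliation of U′ and vary smoothly with τ. -/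
open Set Filter Topology
open scoped ContDiff

universe u

section GeometricBounds

variable {E V W Z : Type*} [NormedAddCommGroup E] [NormedSpace ℝ E]
  [NormedAddCommGroup V] [NormedSpace ℝ V] [NormedAddCommGroup W] [NormedSpace ℝ W]
  [NormedAddCommGroup Z] [NormedSpace ℝ Z]

/-- The functions `u n` are smooth on `Ω` and their derivatives of order at most `k` are bounded
on `Ω` by a constant multiple of `q ^ n`. -/
def GeomBound (Ω : Set E) (k : ℕ) (q : ℝ) (u : ℕ → E → V) : Prop :=
  (∀ n, ContDiffOn ℝ ∞ (u n) Ω) ∧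
    ∃ C, 0 ≤ C ∧ ∀ n, ∀ x ∈ Ω, ∀ j ≤ k, ‖iteratedFDerivWithin ℝ j (u n) Ω x‖ ≤ C * q ^ n

/-- The derivatives of order at most `k` of the functions `u n` decay exponentially on `Ω`. -/
def GeomDecay (Ω : Set E) (k : ℕ) (u : ℕ → E → V) : Prop :=
  ∃ q, 0 ≤ q ∧ q < 1 ∧ GeomBound Ω k q u

variable {Ω : Set E} {k l : ℕ} {q q' : ℝ}

theorem GeomBound.mono {u : ℕ → E → V} (h : GeomBound Ω k q u) (hq : 0 ≤ q) (hqq' : q ≤ q')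
    (hl : l ≤ k) : GeomBound Ω l q' u := by
  obtain ⟨hs, C, hC, h⟩ := h
  refine ⟨hs, C, hC, fun n x hx j hj => (h n x hx j (hj.trans hl)).trans ?_⟩
  gcongr

theorem GeomDecay.mono {u : ℕ → E → V} (h : GeomDecay Ω k u) (hl : l ≤ k) : GeomDecay Ω l u := by
  obtain ⟨q, h0, h1, h⟩ := h
  exact ⟨q, h0, h1, h.mono h0 le_rfl hl⟩

theorem GeomDecay.bounded {u : ℕ → E → V} (h : GeomDecay Ω k u) : GeomBound Ω k 1 u := by
  obtain ⟨q, h0, h1, h⟩ := h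
  exact h.mono h0 h1.le le_rfl

theorem GeomBound.congr {u v : ℕ → E → V} (h : GeomBound Ω k q u) (huv : ∀ n, EqOn (v n) (u n) Ω) :
    GeomBound Ω k q v := by
  obtain ⟨hs, C, hC, h⟩ := h
  refine ⟨fun n => (hs n).congr (huv n), C, hC, fun n x hx j hj => ?_⟩
  rw [iteratedFDerivWithin_congr (huv n) hx]
  exact h n x hx j hj

theorem GeomDecay.congr {u v : ℕ → E → V} (h : GeomDecay Ω k u) (huv : ∀ n, EqOn (v n) (u n) Ω) :
    GeomDecay Ω k v := by
  obtain ⟨q, h0, h1, h⟩ := h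
  exact ⟨q, h0, h1, h.congr huv⟩

theorem GeomBound.add {u v : ℕ → E → V} (hΩ : IsOpen Ω) (hu : GeomBound Ω k q u)
    (hv : GeomBound Ω k q v) : GeomBound Ω k q (fun n x => u n x + v n x) := by
  obtain ⟨hs, C, hC, h⟩ := hu
  obtain ⟨hs', C', hC', h'⟩ := hv
  refine ⟨fun n => (hs n).add (hs' n), C + C', by positivity, fun n x hx j hj => ?_⟩
  rw [fun_iteratedFDerivWithin_add_apply
    (((hs n).of_le (by exact_mod_cast le_top)).contDiffWithinAt hx)
    (((hs' n).of_le (by exact_mod_cast le_top)).contDiffWithinAt hx) hΩ.uniqueDiffOn hx, add_mul]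
  exact (norm_add_le _ _).trans (add_le_add (h n x hx j hj) (h' n x hx j hj))

theorem GeomDecay.add {u v : ℕ → E → V} (hΩ : IsOpen Ω) (hu : GeomDecay Ω k u)
    (hv : GeomDecay Ω k v) : GeomDecay Ω k (fun n x => u n x + v n x) := by
  obtain ⟨q, h0, h1, h⟩ := hu
  obtain ⟨q', h0', h1', h'⟩ := hv
  exact ⟨max q q', h0.trans (le_max_left _ _), max_lt h1 h1',
    (h.mono h0 (le_max_left _ _) le_rfl).add hΩ (h'.mono h0' (le_max_right _ _) le_rfl)⟩

theorem GeomBound.bilinear (B : V →L[ℝ] W →L[ℝ] Z) {u : ℕ → E → V} {v : ℕ → E → W}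
    (hΩ : IsOpen Ω) (hq : 0 ≤ q) (hq' : 0 ≤ q') (hu : GeomBound Ω k q u)
    (hv : GeomBound Ω k q' v) : GeomBound Ω k (q * q') (fun n x => B (u n x) (v n x)) := by
  obtain ⟨hs, C, hC, h⟩ := hu
  obtain ⟨hs', C', hC', h'⟩ := hv
  refine ⟨fun n => B.isBoundedBilinearMap.contDiff.comp₂_contDiffOn (hs n) (hs' n),
    ‖B‖ * (2 ^ k * (C * C')), by positivity, fun n x hx j hj => ?_⟩
  refine (B.norm_iteratedFDerivWithin_le_of_bilinear (hs n) (hs' n) hΩ.uniqueDiffOn hx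
    (n := j) (by exact_mod_cast le_top)).trans ?_
  rw [mul_assoc]
  gcongr
  calc ∑ i ∈ Finset.range (j + 1), (j.choose i : ℝ) * ‖iteratedFDerivWithin ℝ i (u n) Ω x‖ *
        ‖iteratedFDerivWithin ℝ (j - i) (v n) Ω x‖
      ≤ ∑ i ∈ Finset.range (j + 1), (j.choose i : ℝ) * (C * q ^ n) * (C' * q' ^ n) := by
        refine Finset.sum_le_sum fun i hi => ?_
        have hi' : i ≤ k := by have := Finset.mem_range.1 hi; omega
        have := h n x hx i hi'
        have := h' n x hx (j - i) (by omega)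
        gcongr
    _ = 2 ^ j * (C * q ^ n * (C' * q' ^ n)) := by
        simp_rw [mul_assoc, ← Finset.sum_mul]
        have : ∑ i ∈ Finset.range (j + 1), (j.choose i : ℝ) = 2 ^ j := by
          exact_mod_cast Nat.sum_range_choose j
        rw [this]
    _ ≤ 2 ^ k * (C * q ^ n * (C' * q' ^ n)) := by
        gcongr
        norm_num
    _ = 2 ^ k * (C * C') * (q * q') ^ n := by ring

theorem GeomDecay.bilinear_left (B : V →L[ℝ] W →L[ℝ] Z) {u : ℕ → E → V} {v : ℕ → E → W}
    (hΩ : IsOpen Ω) (hu : GeomDecay Ω k u) (hv : GeomBound Ω k 1 v) :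
    GeomDecay Ω k (fun n x => B (u n x) (v n x)) := by
  obtain ⟨q, h0, h1, h⟩ := hu
  refine ⟨q, h0, h1, ?_⟩
  simpa using h.bilinear B hΩ h0 zero_le_one hv

theorem GeomDecay.bilinear_right (B : V →L[ℝ] W →L[ℝ] Z) {u : ℕ → E → V} {v : ℕ → E → W}
    (hΩ : IsOpen Ω) (hu : GeomBound Ω k 1 u) (hv : GeomDecay Ω k v) :
    GeomDecay Ω k (fun n x => B (u n x) (v n x)) := by
  obtain ⟨q, h0, h1, h⟩ := hv
  refine ⟨q, h0, h1, ?_⟩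
  simpa using hu.bilinear B hΩ zero_le_one h0 h

theorem GeomBound.clm_comp (T : V →L[ℝ] W) {u : ℕ → E → V} (hΩ : IsOpen Ω)
    (hu : GeomBound Ω k q u) : GeomBound Ω k q (fun n x => T (u n x)) := by
  obtain ⟨hs, C, hC, h⟩ := hu
  refine ⟨fun n => T.contDiff.comp_contDiffOn (hs n), ‖T‖ * C, by positivity,
    fun n x hx j hj => ?_⟩
  refine (T.norm_iteratedFDerivWithin_comp_left ((hs n).contDiffWithinAt hx) hΩ.uniqueDiffOn hx
    (n := j) (by exact_mod_cast le_top)).trans ?_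
  rw [mul_assoc]
  gcongr
  exact h n x hx j hj

theorem GeomBound.of_fderivWithin {u : ℕ → E → V} (hΩ : IsOpen Ω) (h0 : GeomBound Ω 0 q u)
    (h : GeomBound Ω k q (fun n => fderivWithin ℝ (u n) Ω)) (hq : 0 ≤ q) :
    GeomBound Ω (k + 1) q u := by
  obtain ⟨hs, C, hC, h0⟩ := h0
  obtain ⟨-, C', hC', h⟩ := h
  refine ⟨hs, max C C', hC.trans (le_max_left _ _), fun n x hx j hj => ?_⟩
  rcases j with _ | j
  · refine (h0 n x hx 0 le_rfl).trans ?_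
    gcongr
    exact le_max_left _ _
  · rw [← norm_iteratedFDerivWithin_fderivWithin hΩ.uniqueDiffOn hx]
    refine (h n x hx j (by omega)).trans ?_
    gcongr
    exact le_max_right _ _

theorem ContDiffOn.fderivWithin_infty {f : E → V} (hΩ : IsOpen Ω) (h : ContDiffOn ℝ ∞ f Ω) :
    ContDiffOn ℝ ∞ (fderivWithin ℝ f Ω) Ω :=
  h.fderivWithin hΩ.uniqueDiffOn (by norm_num)

theorem ContDiffOn.hasFDerivWithinAt_fderivWithin {f : E → V} {x : E} (h : ContDiffOn ℝ ∞ f Ω)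
    (hx : x ∈ Ω) : HasFDerivWithinAt f (fderivWithin ℝ f Ω x) Ω x :=
  (h.differentiableOn (by simp) x hx).hasFDerivWithinAt

theorem GeomBound.fderivWithin {u : ℕ → E → V} (hΩ : IsOpen Ω) (h : GeomBound Ω (k + 1) q u) :
    GeomBound Ω k q (fun n => fderivWithin ℝ (u n) Ω) := by
  obtain ⟨hs, C, hC, h⟩ := h
  refine ⟨fun n => (hs n).fderivWithin_infty hΩ, C, hC, fun n x hx j hj => ?_⟩
  rw [norm_iteratedFDerivWithin_fderivWithin hΩ.uniqueDiffOn hx]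
  exact h n x hx _ (by omega)

theorem GeomDecay.fderivWithin {u : ℕ → E → V} (hΩ : IsOpen Ω) (h : GeomDecay Ω (k + 1) u) :
    GeomDecay Ω k (fun n => fderivWithin ℝ (u n) Ω) := by
  obtain ⟨q, h0, h1, h⟩ := h
  exact ⟨q, h0, h1, h.fderivWithin hΩ⟩

theorem GeomDecay.of_fderivWithin {u : ℕ → E → V} (hΩ : IsOpen Ω) (h0 : GeomDecay Ω 0 u)
    (h : GeomDecay Ω k (fun n => _root_.fderivWithin ℝ (u n) Ω)) : GeomDecay Ω (k + 1) u := by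
  obtain ⟨q', h0', h1', h'⟩ := h0
  obtain ⟨q, h0, h1, h⟩ := h
  exact ⟨max q q', h0.trans (le_max_left _ _), max_lt h1 h1',
    GeomBound.of_fderivWithin hΩ (h'.mono h0' (le_max_right _ _) le_rfl)
      (h.mono h0 (le_max_left _ _) le_rfl) (h0.trans (le_max_left _ _))⟩

theorem GeomBound.norm_le {u : ℕ → E → V} (h : GeomBound Ω k q u) :
    ∃ C, 0 ≤ C ∧ ∀ n, ∀ x ∈ Ω, ‖u n x‖ ≤ C * q ^ n := by
  obtain ⟨-, C, hC, h⟩ := h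
  refine ⟨C, hC, fun n x hx => ?_⟩
  simpa using h n x hx 0 (Nat.zero_le _)

theorem geomBound_zero_iff {u : ℕ → E → V} : GeomBound Ω 0 q u ↔
    (∀ n, ContDiffOn ℝ ∞ (u n) Ω) ∧ ∃ C, 0 ≤ C ∧ ∀ n, ∀ x ∈ Ω, ‖u n x‖ ≤ C * q ^ n := by
  refine ⟨fun h => ⟨h.1, h.norm_le⟩, fun ⟨hs, C, hC, h⟩ => ⟨hs, C, hC, fun n x hx j hj => ?_⟩⟩
  obtain rfl : j = 0 := by omega
  simpa using h n x hx

theorem GeomBound.comp {φ : W → V} {D : Set W} {u : ℕ → E → W} (hΩ : IsOpen Ω) (hD : IsOpen D)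
    (hφ : GeomBound D k 1 (fun _ => φ)) (hu : GeomBound Ω k 1 u) (hm : ∀ n, MapsTo (u n) Ω D) :
    GeomBound Ω k 1 (fun n x => φ (u n x)) := by
  obtain ⟨hs, C, hC, h⟩ := hφ
  obtain ⟨hs', C', hC', h'⟩ := hu
  refine ⟨fun n => (hs n).comp (hs' n) (hm n), k.factorial * C * (max C' 1) ^ k, by positivity,
    fun n x hx j hj => ?_⟩
  have hmax : 1 ≤ max C' 1 := le_max_right _ _
  refine (norm_iteratedFDerivWithin_comp_le (hs n) (hs' n) (n := j) (by exact_mod_cast le_top)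
    hD.uniqueDiffOn hΩ.uniqueDiffOn (hm n) hx (C := C) (D := max C' 1) (fun i hi => ?_)
    (fun i hi hij => ?_)).trans ?_
  · simpa using h n _ (hm n hx) i (hi.trans hj)
  · refine (h' n x hx i (hij.trans hj)).trans ?_
    simp only [one_pow, mul_one]
    exact (le_max_left _ _).trans (le_self_pow₀ hmax (by omega))
  · rw [one_pow, mul_one]
    gcongr

end GeometricBounds

/-- A priori bounds for a pair of nonnegative sequences satisfying a triangular linear system of
inequalities, up to exponentially small perturbations. -/
theorem exists_bound_of_linear_recursion {C q q₀ : ℝ} (hC : 0 ≤ C) (hq : 0 ≤ q) (hq1 : q < 1)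
    (hq₀ : 0 ≤ q₀) (hq₀1 : q₀ < 1) :
    ∃ B q₁, 0 ≤ B ∧ 0 ≤ q₁ ∧ q₁ < 1 ∧ ∀ P W : ℕ → ℝ, (∀ n, 0 ≤ P n) → (∀ n, 0 ≤ W n) →
      P 0 ≤ C → W 0 ≤ C →
      (∀ n, P (n + 1) ≤ P n + C * q ^ n * P n + C * W n + C * q ^ n) →
      (∀ n, W (n + 1) ≤ q₀ * W n + C * q ^ n * P n + C * q ^ n) →
      ∀ n, P n ≤ B ∧ W n ≤ B * q₁ ^ n := by
  have h1q₀ : 0 < 1 - q₀ := by linarith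
  set c := C / (1 - q₀) with hc
  have hcC : c * (1 - q₀) = C := div_mul_cancel₀ _ h1q₀.ne'
  have hc0 : 0 ≤ c := by positivity
  set K := (1 + c) * C with hK
  have hK0 : 0 ≤ K := by positivity
  set S := (C + c * C + 1) * Real.exp (K * (1 - q)⁻¹) with hS
  have hS0 : 0 ≤ S := by positivity
  set m := max q q₀ with hm
  have hm1 : m < 1 := max_lt hq1 hq₀1
  set q₁ := (m + 1) / 2 with hq₁
  have hmq₁ : m < q₁ := by rw [hq₁]; linarith
  have hq₁1 : q₁ < 1 := by rw [hq₁]; linarith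
  have hm0 : 0 ≤ m := hq.trans (le_max_left _ _)
  have hq₁0 : 0 ≤ q₁ := hm0.trans hmq₁.le
  have hgap : 0 < q₁ - q₀ := by have := le_max_right q q₀; linarith
  set A := C + (C * S + C) / (q₁ - q₀) with hA
  have hA0 : 0 ≤ A := by positivity
  refine ⟨S + A, q₁, by positivity, hq₁0, hq₁1, fun P W hP hW hP0 hW0 hPs hWs => ?_⟩
  have hprod : ∀ n, P n + c * W n + 1 ≤
      (C + c * C + 1) * Real.exp (K * ∑ i ∈ Finset.range n, q ^ i) := by
    intro n
    induction n with
    | zero =>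
      simp only [Finset.range_zero, Finset.sum_empty, mul_zero, Real.exp_zero, mul_one]
      have := mul_le_mul_of_nonneg_left hW0 hc0
      linarith
    | succ n ih =>
      have hqn : 0 ≤ q ^ n := pow_nonneg hq n
      have step : P (n + 1) + c * W (n + 1) + 1 ≤
          (P n + c * W n + 1) * (1 + K * q ^ n) := by
        have h1 := mul_le_mul_of_nonneg_left (hWs n) hc0
        have h2 : 0 ≤ c * W n * (K * q ^ n) :=
          mul_nonneg (mul_nonneg hc0 (hW n)) (mul_nonneg hK0 hqn)
        have h3 := hPs n
        have h4 : C * W n = c * W n - c * q₀ * W n := by rw [← hcC]; ring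
        rw [hK] at h2 ⊢
        nlinarith
      have hexp : 1 + K * q ^ n ≤ Real.exp (K * q ^ n) := by
        have := Real.add_one_le_exp (K * q ^ n); linarith
      rw [Finset.sum_range_succ, mul_add, Real.exp_add, ← mul_assoc]
      refine step.trans (mul_le_mul ih hexp (by positivity) (by positivity))
  have hsum : ∀ n, ∑ i ∈ Finset.range n, q ^ i ≤ (1 - q)⁻¹ := fun n => by
    rw [← tsum_geometric_of_lt_one hq hq1]
    exact (summable_geometric_of_lt_one hq hq1).sum_le_tsum _ fun i _ => pow_nonneg hq i
  have hPS : ∀ n, P n ≤ S := fun n => by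
    have h1 := hprod n
    have h2 : (C + c * C + 1) * Real.exp (K * ∑ i ∈ Finset.range n, q ^ i) ≤ S := by
      rw [hS]
      gcongr
      exact hsum n
    have := mul_nonneg hc0 (hW n)
    linarith
  have hWA : ∀ n, W n ≤ A * q₁ ^ n := by
    intro n
    induction n with
    | zero =>
      have : 0 ≤ (C * S + C) / (q₁ - q₀) := by positivity
      simp only [pow_zero, mul_one]
      linarith
    | succ n ih =>
      have hqn : q ^ n ≤ q₁ ^ n := pow_le_pow_left₀ hq ((le_max_left q q₀).trans hmq₁.le) n
      have hqn0 : 0 ≤ q ^ n := pow_nonneg hq n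
      have h1 : C * q ^ n * P n ≤ C * q₁ ^ n * S := by
        have := hPS n
        have := hP n
        gcongr
      have h2 : C * q ^ n ≤ C * q₁ ^ n := by gcongr
      have h3 : C * S + C ≤ A * (q₁ - q₀) := by
        rw [hA, add_mul, div_mul_cancel₀ _ hgap.ne']
        have := mul_nonneg hC hgap.le
        linarith
      have h4 := mul_le_mul_of_nonneg_right h3 (pow_nonneg hq₁0 n)
      have h5 := mul_le_mul_of_nonneg_left ih hq₀
      have h6 := hWs n
      rw [pow_succ]
      nlinarith
  intro n
  refine ⟨(hPS n).trans (by linarith), (hWA n).trans ?_⟩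
  gcongr
  linarith

section LinearSystems

variable {E : Type u} [NormedAddCommGroup E] [NormedSpace ℝ E] {Ω : Set E}

/-- Derivatives of all orders of the solutions of a triangular linear recursion with scalar
coefficients, up to exponentially decaying perturbations: the neutral component stays bounded, the
contracted component decays. -/
theorem geomBound_geomDecay_of_linear_recursion (hΩ : IsOpen Ω) (k : ℕ) {q₀ : ℝ} (hq₀ : 0 ≤ q₀)
    (hq₀1 : q₀ < 1) {d d' β ρ : ℕ → E → ℝ} (hd : GeomDecay Ω k d) (hd' : GeomDecay Ω k d')
    (hβ : GeomBound Ω k 1 β) (hρ : GeomBound Ω k 1 ρ) (hρq : ∀ n, ∀ x ∈ Ω, |ρ n x| ≤ q₀) :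
    ∀ {V : Type u} [NormedAddCommGroup V] [NormedSpace ℝ V] {p w e e' : ℕ → E → V},
      (∀ n, ContDiffOn ℝ ∞ (p n) Ω) → (∀ n, ContDiffOn ℝ ∞ (w n) Ω) →
      GeomDecay Ω k e → GeomDecay Ω k e' →
      GeomBound Ω k 1 (fun _ => p 0) → GeomBound Ω k 1 (fun _ => w 0) →
      (∀ n, ∀ x ∈ Ω, p (n + 1) x = p n x + d n x • p n x + β n x • w n x + e n x) →
      (∀ n, ∀ x ∈ Ω, w (n + 1) x = ρ n x • w n x + d' n x • p n x + e' n x) →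
      GeomBound Ω k 1 p ∧ GeomDecay Ω k w := by
  induction k with
  | zero =>
    intro V _ _ p w e e' hps hws he he' hp0 hw0 hp hw
    obtain ⟨q1, hq1, hq1', hd⟩ := hd
    obtain ⟨q2, hq2, hq2', hd'⟩ := hd'
    obtain ⟨q3, hq3, hq3', he⟩ := he
    obtain ⟨q4, hq4, hq4', he'⟩ := he'
    set q := max (max q1 q2) (max q3 q4) with hqdef
    have hq : 0 ≤ q := hq1.trans ((le_max_left _ _).trans (le_max_left _ _))
    have hq' : q < 1 := max_lt (max_lt hq1' hq2') (max_lt hq3' hq4')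
    obtain ⟨C1, hC1, h1⟩ :=
      (hd.mono (q' := q) hq1 ((le_max_left _ _).trans (le_max_left _ _)) le_rfl).norm_le
    obtain ⟨C2, hC2, h2⟩ :=
      (hd'.mono (q' := q) hq2 ((le_max_right _ _).trans (le_max_left _ _)) le_rfl).norm_le
    obtain ⟨C3, hC3, h3⟩ :=
      (he.mono (q' := q) hq3 ((le_max_left _ _).trans (le_max_right _ _)) le_rfl).norm_le
    obtain ⟨C4, hC4, h4⟩ :=
      (he'.mono (q' := q) hq4 ((le_max_right _ _).trans (le_max_right _ _)) le_rfl).norm_le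
    obtain ⟨C5, hC5, h5⟩ := hβ.norm_le
    obtain ⟨C6, hC6, h6⟩ := hp0.norm_le
    obtain ⟨C7, hC7, h7⟩ := hw0.norm_le
    set C := C1 + C2 + C3 + C4 + C5 + C6 + C7 with hC
    obtain ⟨B, q', hB, hq'0, hq'1, H⟩ :=
      exists_bound_of_linear_recursion (C := C) (by positivity) hq hq' hq₀ hq₀1
    have key : ∀ x ∈ Ω, ∀ n, ‖p n x‖ ≤ B ∧ ‖w n x‖ ≤ B * q' ^ n := by
      intro x hx
      refine H (fun n => ‖p n x‖) (fun n => ‖w n x‖) (fun n => norm_nonneg _)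
        (fun n => norm_nonneg _) ((h6 0 x hx).trans ?_) ((h7 0 x hx).trans ?_)
        (fun n => ?_) (fun n => ?_)
      · rw [pow_zero]; linarith
      · rw [pow_zero]; linarith
      · have hqn : 0 ≤ q ^ n := pow_nonneg hq n
        have a1 : ‖d n x‖ ≤ C * q ^ n :=
          (h1 n x hx).trans (mul_le_mul_of_nonneg_right (by linarith) hqn)
        have a2 : ‖β n x‖ ≤ C := by
          have := h5 n x hx
          rw [one_pow] at this
          linarith
        have a3 : ‖e n x‖ ≤ C * q ^ n :=
          (h3 n x hx).trans (mul_le_mul_of_nonneg_right (by linarith) hqn)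
        rw [hp n x hx]
        refine norm_add₄_le.trans ?_
        rw [norm_smul, norm_smul]
        gcongr
      · have hqn : 0 ≤ q ^ n := pow_nonneg hq n
        have a1 : ‖d' n x‖ ≤ C * q ^ n :=
          (h2 n x hx).trans (mul_le_mul_of_nonneg_right (by linarith) hqn)
        have a2 : ‖ρ n x‖ ≤ q₀ := hρq n x hx
        have a3 : ‖e' n x‖ ≤ C * q ^ n :=
          (h4 n x hx).trans (mul_le_mul_of_nonneg_right (by linarith) hqn)
        rw [hw n x hx]
        refine norm_add₃_le.trans ?_
        rw [norm_smul, norm_smul]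
        gcongr
    refine ⟨geomBound_zero_iff.2 ⟨hps, B, hB, fun n x hx => ?_⟩, q', hq'0, hq'1,
      geomBound_zero_iff.2 ⟨hws, B, hB, fun n x hx => (key x hx n).2⟩⟩
    simpa using (key x hx n).1
  | succ k ih =>
    intro V _ _ p w e e' hps hws he he' hp0 hw0 hp hw
    have ih := @ih (hd.mono k.le_succ) (hd'.mono k.le_succ)
      (hβ.mono zero_le_one le_rfl k.le_succ) (hρ.mono zero_le_one le_rfl k.le_succ)
    obtain ⟨bp, bw⟩ := @ih V _ _ p w e e' hps hws (he.mono k.le_succ) (he'.mono k.le_succ)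
      (hp0.mono zero_le_one le_rfl k.le_succ) (hw0.mono zero_le_one le_rfl k.le_succ) hp hw
    let B := ContinuousLinearMap.smulRightL ℝ E V
    have hB : ∀ c v, B c v = c.smulRight v := fun _ _ => rfl
    obtain ⟨bp', bw'⟩ := @ih (E →L[ℝ] V) _ _ (fun n => fderivWithin ℝ (p n) Ω)
      (fun n => fderivWithin ℝ (w n) Ω)
      (fun n x => B (fderivWithin ℝ (d n) Ω x) (p n x) + B (fderivWithin ℝ (β n) Ω x) (w n x) +
        fderivWithin ℝ (e n) Ω x)
      (fun n x => B (fderivWithin ℝ (ρ n) Ω x) (w n x) + B (fderivWithin ℝ (d' n) Ω x) (p n x) +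
        fderivWithin ℝ (e' n) Ω x)
      (fun n => (hps n).fderivWithin_infty hΩ) (fun n => (hws n).fderivWithin_infty hΩ)
      (((GeomDecay.bilinear_left B hΩ (hd.fderivWithin hΩ) bp).add hΩ
        (GeomDecay.bilinear_right B hΩ (hβ.fderivWithin hΩ) bw)).add hΩ (he.fderivWithin hΩ))
      (((GeomDecay.bilinear_right B hΩ (hρ.fderivWithin hΩ) bw).add hΩ
        (GeomDecay.bilinear_left B hΩ (hd'.fderivWithin hΩ) bp)).add hΩ (he'.fderivWithin hΩ))
      (hp0.fderivWithin hΩ) (hw0.fderivWithin hΩ)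
      (fun n x hx => by
        rw [fderivWithin_congr (hp n) (hp n x hx)]
        have hpn := (hps n).hasFDerivWithinAt_fderivWithin hx
        have hwn := (hws n).hasFDerivWithinAt_fderivWithin hx
        have hdn := (hd.bounded.1 n).hasFDerivWithinAt_fderivWithin hx
        have hβn := (hβ.1 n).hasFDerivWithinAt_fderivWithin hx
        have hen := (he.bounded.1 n).hasFDerivWithinAt_fderivWithin hx
        refine (((hpn.add (hdn.smul hpn)).add (hβn.smul hwn)).add hen).fderivWithin
          (hΩ.uniqueDiffOn x hx) |>.trans ?_
        simp only [hB]
        abel)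
      (fun n x hx => by
        rw [fderivWithin_congr (hw n) (hw n x hx)]
        have hpn := (hps n).hasFDerivWithinAt_fderivWithin hx
        have hwn := (hws n).hasFDerivWithinAt_fderivWithin hx
        have hρn := (hρ.1 n).hasFDerivWithinAt_fderivWithin hx
        have hdn := (hd'.bounded.1 n).hasFDerivWithinAt_fderivWithin hx
        have hen := (he'.bounded.1 n).hasFDerivWithinAt_fderivWithin hx
        refine (((hρn.smul hwn).add (hdn.smul hpn)).add hen).fderivWithin
          (hΩ.uniqueDiffOn x hx) |>.trans ?_
        simp only [hB]
        abel)
    exact ⟨GeomBound.of_fderivWithin hΩ (bp.mono zero_le_one le_rfl (Nat.zero_le _)) bp'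
        zero_le_one,
      GeomDecay.of_fderivWithin hΩ (bw.mono (Nat.zero_le _)) bw'⟩

/-- A series whose terms have exponentially decaying derivatives up to order `k` is `C^k`. -/
theorem GeomDecay.contDiffOn_tsum (hΩ : IsOpen Ω) (hΩc : IsPreconnected Ω) (k : ℕ) :
    ∀ {V : Type u} [NormedAddCommGroup V] [NormedSpace ℝ V] [CompleteSpace V] {f : ℕ → E → V},
      GeomDecay Ω k f → ContDiffOn ℝ k (fun x => ∑' n, f n x) Ω := by
  induction k with
  | zero =>
    intro V _ _ _ f hf
    obtain ⟨q, hq, hq1, hf⟩ := hf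
    obtain ⟨C, hC, h⟩ := hf.norm_le
    simp only [CharP.cast_eq_zero, contDiffOn_zero]
    exact continuousOn_tsum (fun n => (hf.1 n).continuousOn)
      ((summable_geometric_of_lt_one hq hq1).mul_left C) h
  | succ k ih =>
    intro V _ _ _ f hf
    have hf' := ih (hf.fderivWithin hΩ)
    obtain ⟨q, hq, hq1, hf⟩ := hf
    obtain ⟨C, hC, h⟩ := hf.norm_le
    obtain ⟨C', hC', h'⟩ := (hf.fderivWithin hΩ).norm_le
    have hd : ∀ x ∈ Ω, HasFDerivAt (fun x => ∑' n, f n x)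
        (∑' n, _root_.fderivWithin ℝ (f n) Ω x) x := by
      intro x hx
      refine hasFDerivAt_tsum_of_isPreconnected (f' := fun n x => _root_.fderivWithin ℝ (f n) Ω x)
        ((summable_geometric_of_lt_one hq hq1).mul_left C')
        hΩ hΩc (fun n y hy => ?_) h' hx ?_ hx
      · exact (((hf.1 n).differentiableOn (by simp) _ hy).hasFDerivWithinAt).hasFDerivAt
          (hΩ.mem_nhds hy)
      · exact Summable.of_norm_bounded ((summable_geometric_of_lt_one hq hq1).mul_left C)
          fun n => h n x hx
    rw [Nat.cast_succ, contDiffOn_succ_iff_fderivWithin hΩ.uniqueDiffOn]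
    refine ⟨fun x hx => (hd x hx).differentiableAt.differentiableWithinAt, by simp, ?_⟩
    exact hf'.congr fun x hx => (hd x hx).hasFDerivWithinAt.fderivWithin (hΩ.uniqueDiffOn x hx)

end LinearSystems

/-- Mean value inequality along a segment, using only the derivative in its direction. -/
theorem norm_image_sub_le_of_norm_fderiv_segment_le {E V : Type*} [NormedAddCommGroup E]
    [NormedSpace ℝ E] [NormedAddCommGroup V] [NormedSpace ℝ V] {φ : E → V} {φ' : E → E →L[ℝ] V}
    {x y : E} {C : ℝ} (h : ∀ z ∈ segment ℝ x y, HasFDerivAt φ (φ' z) z)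
    (hC : ∀ z ∈ segment ℝ x y, ‖φ' z (y - x)‖ ≤ C) : ‖φ y - φ x‖ ≤ C := by
  have hmem : ∀ t ∈ Icc (0 : ℝ) 1, x + t • (y - x) ∈ segment ℝ x y := fun t ht => by
    rw [segment_eq_image']
    exact ⟨t, ht, rfl⟩
  have hd : ∀ t ∈ Icc (0 : ℝ) 1, HasDerivWithinAt (fun t : ℝ => φ (x + t • (y - x)))
      (φ' (x + t • (y - x)) (y - x)) (Icc 0 1) t := fun t ht => by
    have h1 : HasDerivAt (fun t : ℝ => x + t • (y - x)) (y - x) t := by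
      simpa using ((hasDerivAt_id t).smul_const (y - x)).const_add x
    exact ((h _ (hmem t ht)).comp_hasDerivAt t h1).hasDerivWithinAt
  simpa using norm_image_sub_le_of_norm_deriv_le_segment_01' hd
    (fun t ht => hC _ (hmem t (Ico_subset_Icc_self ht)))

/-- A smooth self-map of a convex planar domain which fixes the points of the horizontal axis and
contracts the vertical coordinate. -/
structure NormallyContracting (Ω : Set (ℝ × ℝ)) (G : ℝ × ℝ → ℝ × ℝ) (q : ℝ) : Prop where
  isOpen : IsOpen Ω
  convex : Convex ℝ Ω
  mapsTo : MapsTo G Ω Ω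
  bounded : ∀ k, GeomBound Ω k 1 (fun _ => G)
  boundedId : ∀ k, GeomBound Ω k 1 (fun _ => (id : ℝ × ℝ → ℝ × ℝ))
  axis_mem : ∀ x ∈ Ω, (x.1, (0 : ℝ)) ∈ Ω
  fixed : ∀ x ∈ Ω, G (x.1, 0) = (x.1, 0)
  nonneg : 0 ≤ q
  lt_one : q < 1
  contracting : ∀ x ∈ Ω, |(fderivWithin ℝ G Ω x (0, 1)).2| ≤ q

section Planar

variable {Ω : Set (ℝ × ℝ)} {G : ℝ × ℝ → ℝ × ℝ} {q : ℝ} {φ : ℝ × ℝ → ℝ}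

theorem ContDiffOn.hasFDerivAt_fderivWithin {V : Type*} [NormedAddCommGroup V] [NormedSpace ℝ V]
    {φ : ℝ × ℝ → V} {x : ℝ × ℝ} (hφ : ContDiffOn ℝ ∞ φ Ω) (hΩ : IsOpen Ω)
    (hx : x ∈ Ω) : HasFDerivAt φ (fderivWithin ℝ φ Ω x) x :=
  (hφ.hasFDerivWithinAt_fderivWithin hx).hasFDerivAt (hΩ.mem_nhds hx)

theorem GeomBound.fderivWithin_apply {u : ℕ → ℝ × ℝ → ℝ} {k : ℕ} (hΩ : IsOpen Ω) (e : ℝ × ℝ)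
    (h : GeomBound Ω (k + 1) q u) :
    GeomBound Ω k q (fun n x => _root_.fderivWithin ℝ (u n) Ω x e) :=
  (h.fderivWithin hΩ).clm_comp (ContinuousLinearMap.apply ℝ ℝ e) hΩ

/-- The derivative along the axis of a function that equals `c * t` at the axis point `(t, 0)`. -/
theorem fderivWithin_axis_eq {c : ℝ} (hΩ : IsOpen Ω) (hφ : ContDiffOn ℝ ∞ φ Ω)
    (h0 : ∀ t : ℝ, (t, (0 : ℝ)) ∈ Ω → φ (t, 0) = c * t) {t : ℝ} (ht : (t, (0 : ℝ)) ∈ Ω) :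
    fderivWithin ℝ φ Ω (t, 0) (1, 0) = c := by
  have h1 : HasDerivAt (fun s : ℝ => (s, (0 : ℝ))) (1, 0) t :=
    (hasDerivAt_id t).prodMk (hasDerivAt_const t 0)
  have h2 := (hφ.hasFDerivAt_fderivWithin hΩ ht).comp_hasDerivAt t h1
  have h3 : HasDerivAt (fun s : ℝ => c * s) c t := by
    simpa using (hasDerivAt_id t).const_mul c
  have h4 : (φ ∘ fun s : ℝ => (s, (0 : ℝ))) =ᶠ[𝓝 t] fun s => c * s := by
    filter_upwards [h1.continuousAt.preimage_mem_nhds (hΩ.mem_nhds ht)] with s hs using h0 s hs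
  exact h2.unique (h3.congr_of_eventuallyEq h4)

namespace NormallyContracting

theorem iterate_mapsTo (hG : NormallyContracting Ω G q)
    (n : ℕ) : MapsTo G^[n] Ω Ω := hG.mapsTo.iterate n

theorem contDiffOn_iterate (hG : NormallyContracting Ω G q) (n : ℕ) : ContDiffOn ℝ ∞ G^[n] Ω := by
  induction n with
  | zero => exact contDiffOn_id
  | succ n ih =>
    rw [Function.iterate_succ']
    exact ((hG.bounded 0).1 0).comp ih (hG.iterate_mapsTo n)

theorem abs_sub_axis_le (hG : NormallyContracting Ω G q) {C : ℝ} (hφ : ContDiffOn ℝ ∞ φ Ω)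
    (hC : ∀ x ∈ Ω, |fderivWithin ℝ φ Ω x (0, 1)| ≤ C) {x : ℝ × ℝ} (hx : x ∈ Ω) :
    |φ x - φ (x.1, 0)| ≤ C * |x.2| := by
  have hseg := hG.convex.segment_subset (hG.axis_mem x hx) hx
  refine norm_image_sub_le_of_norm_fderiv_segment_le
    (fun z hz => hφ.hasFDerivAt_fderivWithin hG.isOpen (hseg hz)) fun z hz => ?_
  have : x - (x.1, 0) = x.2 • ((0, 1) : ℝ × ℝ) := by ext <;> simp
  rw [this, map_smul, norm_smul, mul_comm]
  exact mul_le_mul_of_nonneg_right (hC z (hseg hz)) (norm_nonneg _)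

theorem exists_abs_le (hG : NormallyContracting Ω G q) (hφ : ∀ k, GeomBound Ω k 1 (fun _ => φ))
    (h0 : ∀ t : ℝ, (t, (0 : ℝ)) ∈ Ω → φ (t, 0) = 0) :
    ∃ C, 0 ≤ C ∧ ∀ x ∈ Ω, |φ x| ≤ C * |x.2| := by
  obtain ⟨C, hC, h⟩ := ((hφ 1).fderivWithin_apply hG.isOpen (0, 1)).norm_le
  refine ⟨C, hC, fun x hx => ?_⟩
  have := hG.abs_sub_axis_le ((hφ 0).1 0) (C := C) (fun x hx => by simpa using h 0 x hx) hx
  simpa [h0 _ (hG.axis_mem x hx)] using this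

theorem bounded_fst (hG : NormallyContracting Ω G q)
    : ∀ k, GeomBound Ω k 1 (fun _ x => (G x).1 - x.1) := fun k =>
  (((hG.bounded k).clm_comp (ContinuousLinearMap.fst ℝ ℝ ℝ) hG.isOpen).add hG.isOpen
    ((hG.boundedId k).clm_comp (-ContinuousLinearMap.fst ℝ ℝ ℝ) hG.isOpen)).congr
    fun n x hx => by simp [sub_eq_add_neg]

theorem bounded_snd (hG : NormallyContracting Ω G q)
    : ∀ k, GeomBound Ω k 1 (fun _ x => (G x).2) := fun k =>
  (hG.bounded k).clm_comp (ContinuousLinearMap.snd ℝ ℝ ℝ) hG.isOpen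

theorem fixed' (hG : NormallyContracting Ω G q)
    {t : ℝ} (ht : (t, (0 : ℝ)) ∈ Ω) : G (t, 0) = (t, 0) := hG.fixed _ ht

theorem abs_partial_snd_le (hG : NormallyContracting Ω G q) {x : ℝ × ℝ} (hx : x ∈ Ω) :
    |fderivWithin ℝ (fun x => (G x).2) Ω x (0, 1)| ≤ q := by
  have h1 := ((hG.bounded 0).1 0).hasFDerivWithinAt_fderivWithin hx
  rw [h1.snd.fderivWithin (hG.isOpen.uniqueDiffOn x hx)]
  exact hG.contracting x hx

theorem abs_snd_le (hG : NormallyContracting Ω G q)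
    {x : ℝ × ℝ} (hx : x ∈ Ω) : |(G x).2| ≤ q * |x.2| := by
  have := hG.abs_sub_axis_le ((hG.bounded_snd 0).1 0) (fun x hx => hG.abs_partial_snd_le hx) hx
  simpa [hG.fixed x hx] using this

theorem abs_iterate_snd_le (hG : NormallyContracting Ω G q) (n : ℕ) {x : ℝ × ℝ} (hx : x ∈ Ω) :
    |(G^[n] x).2| ≤ |x.2| * q ^ n := by
  induction n with
  | zero => simp
  | succ n ih =>
    rw [Function.iterate_succ_apply', pow_succ]
    refine (hG.abs_snd_le (hG.iterate_mapsTo n hx)).trans ?_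
    have := mul_le_mul_of_nonneg_left ih hG.nonneg
    linarith

theorem fderivWithin_comp_iterate (hG : NormallyContracting Ω G q)
    (hφ : ContDiffOn ℝ ∞ φ Ω) (n : ℕ) {x : ℝ × ℝ} (hx : x ∈ Ω) :
    fderivWithin ℝ (fun x => φ (G^[n] x)) Ω x =
      fderivWithin ℝ φ Ω (G^[n] x) (1, 0) • fderivWithin ℝ (fun x => (G^[n] x).1) Ω x +
      fderivWithin ℝ φ Ω (G^[n] x) (0, 1) • fderivWithin ℝ (fun x => (G^[n] x).2) Ω x := by
  have hu := hG.isOpen.uniqueDiffOn (𝕜 := ℝ) x hx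
  have h1 := (hG.contDiffOn_iterate n).hasFDerivWithinAt_fderivWithin hx
  have h2 := (hφ.hasFDerivAt_fderivWithin hG.isOpen (hG.iterate_mapsTo n hx)).comp_hasFDerivWithinAt
    x h1
  rw [h1.fst.fderivWithin hu, h1.snd.fderivWithin hu]
  refine (h2.fderivWithin hu).trans (ContinuousLinearMap.ext fun y => ?_)
  set T : ℝ × ℝ →L[ℝ] ℝ := fderivWithin ℝ φ Ω (G^[n] x)
  set z : ℝ × ℝ := fderivWithin ℝ G^[n] Ω x y
  have : z = z.1 • ((1, 0) : ℝ × ℝ) + z.2 • ((0, 1) : ℝ × ℝ) := by ext <;> simp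
  change T z = T (1, 0) * z.1 + T (0, 1) * z.2
  calc T z = T (z.1 • ((1, 0) : ℝ × ℝ) + z.2 • ((0, 1) : ℝ × ℝ)) := by rw [← this]
    _ = T (1, 0) * z.1 + T (0, 1) * z.2 := by
      rw [map_add, map_smul, map_smul, smul_eq_mul, smul_eq_mul, mul_comm, mul_comm z.2]

/-- All derivatives of the iterates are bounded, and functions vanishing on the axis decay along
orbits together with all their derivatives. -/
theorem iterate_bounds (hG : NormallyContracting Ω G q)
    (k : ℕ) : GeomBound Ω k 1 (fun n x => G^[n] x) ∧
    ∀ φ : ℝ × ℝ → ℝ, (∀ l, GeomBound Ω l 1 (fun _ => φ)) →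
      (∀ t : ℝ, (t, (0 : ℝ)) ∈ Ω → φ (t, 0) = 0) → GeomDecay Ω k (fun n x => φ (G^[n] x)) := by
  have hΩ := hG.isOpen
  have decay₀ : ∀ φ : ℝ × ℝ → ℝ, (∀ l, GeomBound Ω l 1 (fun _ => φ)) →
      (∀ t : ℝ, (t, (0 : ℝ)) ∈ Ω → φ (t, 0) = 0) → GeomDecay Ω 0 (fun n x => φ (G^[n] x)) := by
    intro φ hφ h0
    obtain ⟨C, hC, h⟩ := hG.exists_abs_le hφ h0
    obtain ⟨R, hR, hR'⟩ := (hG.boundedId 0).norm_le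
    refine ⟨q, hG.nonneg, hG.lt_one, geomBound_zero_iff.2
      ⟨fun n => ((hφ 0).1 0).comp (hG.contDiffOn_iterate n) (hG.iterate_mapsTo n), C * R,
        by positivity, fun n x hx => ?_⟩⟩
    refine (h _ (hG.iterate_mapsTo n hx)).trans ?_
    have hx2 : |x.2| ≤ R := by
      have := hR' 0 x hx
      simp only [id, one_pow, mul_one] at this
      exact (norm_snd_le x).trans this
    have hqn := pow_nonneg hG.nonneg n
    calc C * |(G^[n] x).2| ≤ C * (R * q ^ n) := by
          gcongr
          exact (hG.abs_iterate_snd_le n hx).trans (by gcongr)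
      _ = C * R * q ^ n := by ring
  induction k with
  | zero =>
    refine ⟨geomBound_zero_iff.2 ⟨hG.contDiffOn_iterate, ?_⟩, decay₀⟩
    obtain ⟨R, hR, hR'⟩ := (hG.boundedId 0).norm_le
    exact ⟨R, hR, fun n x hx => by simpa using hR' 0 _ (hG.iterate_mapsTo n hx)⟩
  | succ k ih =>
    obtain ⟨ihX, ihφ⟩ := ih
    have bddPartial : ∀ {φ : ℝ × ℝ → ℝ} (e : ℝ × ℝ), (∀ l, GeomBound Ω l 1 (fun _ => φ)) →
        ∀ l, GeomBound Ω l 1 (fun _ x => fderivWithin ℝ φ Ω x e) := fun e hφ l =>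
      (hφ (l + 1)).fderivWithin_apply hΩ e
    have bddComp : ∀ {φ : ℝ × ℝ → ℝ}, (∀ l, GeomBound Ω l 1 (fun _ => φ)) →
        GeomBound Ω k 1 (fun n x => φ (G^[n] x)) := fun hφ =>
      GeomBound.comp hΩ hΩ (hφ k) ihX hG.iterate_mapsTo
    have decayPartial : ∀ {φ : ℝ × ℝ → ℝ}, (∀ l, GeomBound Ω l 1 (fun _ => φ)) →
        (∀ t : ℝ, (t, (0 : ℝ)) ∈ Ω → φ (t, 0) = 0) →
        GeomDecay Ω k (fun n x => fderivWithin ℝ φ Ω (G^[n] x) (1, 0)) := fun hφ h0 =>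
      ihφ _ (bddPartial (1, 0) hφ) fun t ht =>
        fderivWithin_axis_eq hΩ ((hφ 0).1 0) (c := 0) (by simpa using h0) ht
    have hF0 : ∀ t : ℝ, (t, (0 : ℝ)) ∈ Ω → (G (t, 0)).1 - t = 0 := fun t ht => by
      simp [hG.fixed' ht]
    have hH0 : ∀ t : ℝ, (t, (0 : ℝ)) ∈ Ω → (G (t, 0)).2 = 0 := fun t ht => by
      simp [hG.fixed' ht]
    have sfst : ∀ n, ContDiffOn ℝ ∞ (fun x => (G^[n] x).1) Ω := fun n =>
      (hG.contDiffOn_iterate n).fst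
    have ssnd : ∀ n, ContDiffOn ℝ ∞ (fun x => (G^[n] x).2) Ω := fun n =>
      (hG.contDiffOn_iterate n).snd
    have zeroDecay : GeomDecay Ω k (fun _ _ => (0 : ℝ × ℝ →L[ℝ] ℝ)) :=
      ⟨0, le_rfl, zero_lt_one, fun n => contDiffOn_const, 0, le_rfl, fun n x hx j hj => by simp⟩
    have b₁ : ∀ l, GeomBound Ω l 1 (fun _ x => (G^[0] x).1) := fun l =>
      (hG.boundedId l).clm_comp (ContinuousLinearMap.fst ℝ ℝ ℝ) hΩ
    have b₂ : ∀ l, GeomBound Ω l 1 (fun _ x => (G^[0] x).2) := fun l =>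
      (hG.boundedId l).clm_comp (ContinuousLinearMap.snd ℝ ℝ ℝ) hΩ
    obtain ⟨bp, bw⟩ := geomBound_geomDecay_of_linear_recursion hΩ k hG.nonneg hG.lt_one
      (decayPartial hG.bounded_fst hF0) (decayPartial hG.bounded_snd hH0)
      (bddComp (bddPartial (0, 1) hG.bounded_fst)) (bddComp (bddPartial (0, 1) hG.bounded_snd))
      (fun n x hx => hG.abs_partial_snd_le (hG.iterate_mapsTo n hx))
      (p := fun n => fderivWithin ℝ (fun x => (G^[n] x).1) Ω)
      (w := fun n => fderivWithin ℝ (fun x => (G^[n] x).2) Ω)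
      (fun n => (sfst n).fderivWithin_infty hΩ) (fun n => (ssnd n).fderivWithin_infty hΩ)
      zeroDecay zeroDecay ((b₁ (k + 1)).fderivWithin hΩ) ((b₂ (k + 1)).fderivWithin hΩ)
      (fun n x hx => by
        have h1 : (fun x => (G^[n + 1] x).1) =
            fun x => (G^[n] x).1 + ((G (G^[n] x)).1 - (G^[n] x).1) := by
          funext x
          rw [Function.iterate_succ_apply']
          ring
        have h2 := (((hG.bounded_fst 0).1 0).comp (hG.contDiffOn_iterate n)
          (hG.iterate_mapsTo n)).hasFDerivWithinAt_fderivWithin hx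
        rw [h1, add_zero, add_assoc]
        refine (((sfst n).hasFDerivWithinAt_fderivWithin hx).add h2).fderivWithin
          (hΩ.uniqueDiffOn x hx) |>.trans ?_
        congr 1
        exact hG.fderivWithin_comp_iterate ((hG.bounded_fst 0).1 0) n hx)
      (fun n x hx => by
        have h1 : (fun x => (G^[n + 1] x).2) = fun x => (G (G^[n] x)).2 := by
          funext x
          rw [Function.iterate_succ_apply']
        rw [h1, add_zero, hG.fderivWithin_comp_iterate ((hG.bounded_snd 0).1 0) n hx, add_comm])
    have fstBound : GeomBound Ω (k + 1) 1 (fun n x => (G^[n] x).1) :=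
      GeomBound.of_fderivWithin hΩ ((ihX.mono zero_le_one le_rfl (Nat.zero_le _)).clm_comp
        (ContinuousLinearMap.fst ℝ ℝ ℝ) hΩ) bp zero_le_one
    have sndBound : GeomBound Ω (k + 1) 1 (fun n x => (G^[n] x).2) :=
      GeomBound.of_fderivWithin hΩ ((ihX.mono zero_le_one le_rfl (Nat.zero_le _)).clm_comp
        (ContinuousLinearMap.snd ℝ ℝ ℝ) hΩ) bw.bounded zero_le_one
    refine ⟨((fstBound.clm_comp (ContinuousLinearMap.inl ℝ ℝ ℝ) hΩ).add hΩ
      (sndBound.clm_comp (ContinuousLinearMap.inr ℝ ℝ ℝ) hΩ)).congr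
      fun n x hx => by ext <;> simp, fun φ hφ h0 => ?_⟩
    refine GeomDecay.of_fderivWithin hΩ (decay₀ φ hφ h0) ?_
    refine ((GeomDecay.bilinear_left (ContinuousLinearMap.lsmul ℝ ℝ) hΩ
      (decayPartial hφ h0) bp).add hΩ (GeomDecay.bilinear_right (ContinuousLinearMap.lsmul ℝ ℝ) hΩ
      (bddComp (bddPartial (0, 1) hφ)) bw)).congr fun n x hx => ?_
    exact hG.fderivWithin_comp_iterate ((hφ 0).1 0) n hx

/-- The asymptotic phase: every orbit converges to a point of the axis that depends smoothly on the
initial point, and is close to its projection on the axis in the `C¹` sense. -/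
theorem exists_asymptotic_phase (hG : NormallyContracting Ω G q)
    : ∃ h : ℝ × ℝ → ℝ, ContDiffOn ℝ ∞ h Ω ∧
    (∀ x ∈ Ω, Tendsto (fun n => G^[n] x) atTop (𝓝 (h x, 0))) ∧
    (∃ M, 0 ≤ M ∧ ∀ x ∈ Ω, |h x - x.1| ≤ M * |x.2|) ∧
    ∃ K, 0 ≤ K ∧ ∀ x ∈ Ω, ∀ y ∈ Ω, x.2 = y.2 →
      |(h y - y.1) - (h x - x.1)| ≤ K * |x.2| * |y.1 - x.1| := by
  have hΩ := hG.isOpen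
  have hF0 : ∀ t : ℝ, (t, (0 : ℝ)) ∈ Ω → (G (t, 0)).1 - t = 0 := fun t ht => by
    simp [hG.fixed' ht]
  let F : ℝ × ℝ → ℝ := fun x => (G x).1 - x.1
  obtain ⟨C, hC, hCF⟩ := hG.exists_abs_le hG.bounded_fst hF0
  have hFn : ∀ n, ∀ x ∈ Ω, ‖F (G^[n] x)‖ ≤ C * |x.2| * q ^ n := fun n x hx => by
    refine (hCF _ (hG.iterate_mapsTo n hx)).trans ?_
    rw [mul_assoc]
    gcongr
    exact hG.abs_iterate_snd_le n hx
  have hgeo := summable_geometric_of_lt_one hG.nonneg hG.lt_one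
  have hsum : ∀ x ∈ Ω, Summable fun n => F (G^[n] x) := fun x hx =>
    Summable.of_norm_bounded (hgeo.mul_left (C * |x.2|)) fun n => hFn n x hx
  let h : ℝ × ℝ → ℝ := fun x => x.1 + ∑' n, F (G^[n] x)
  have hpart : ∀ x n, x.1 + ∑ i ∈ Finset.range n, F (G^[i] x) = (G^[n] x).1 := fun x n => by
    induction n with
    | zero => simp
    | succ n ih =>
      rw [Finset.sum_range_succ, ← add_assoc, ih, Function.iterate_succ_apply']
      simp [F]
  have hfst : ∀ x ∈ Ω, Tendsto (fun n => (G^[n] x).1) atTop (𝓝 (h x)) := fun x hx => by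
    simp_rw [← hpart x]
    exact ((hsum x hx).hasSum.tendsto_sum_nat).const_add x.1
  refine ⟨h, ?_, fun x hx => ?_, ⟨C * (1 - q)⁻¹, ?_, fun x hx => ?_⟩, ?_⟩
  · refine contDiff_fst.contDiffOn.add (contDiffOn_infty.2 fun k => ?_)
    exact GeomDecay.contDiffOn_tsum hΩ hG.convex.isPreconnected k
      ((hG.iterate_bounds k).2 F hG.bounded_fst hF0)
  · refine (hfst x hx).prodMk_nhds ?_
    refine squeeze_zero_norm (fun n => hG.abs_iterate_snd_le n hx) ?_
    simpa using (tendsto_pow_atTop_nhds_zero_of_lt_one hG.nonneg hG.lt_one).const_mul |x.2|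
  · have := sub_pos.2 hG.lt_one
    positivity
  · have h1 := tsum_of_norm_bounded ((hasSum_geometric_of_lt_one hG.nonneg hG.lt_one).mul_left
      (C * |x.2|)) fun n => hFn n x hx
    simp only [h, add_sub_cancel_left]
    rw [Real.norm_eq_abs] at h1
    linarith
  · have b1 := ((hG.iterate_bounds 2).1.clm_comp (ContinuousLinearMap.fst ℝ ℝ ℝ)
      hΩ).fderivWithin_apply hΩ (1, 0)
    obtain ⟨K, hK, hK'⟩ := (b1.fderivWithin_apply hΩ (0, 1)).norm_le
    refine ⟨K, hK, fun x hx y hy hxy => ?_⟩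
    have key : ∀ n, |((G^[n] y).1 - y.1) - ((G^[n] x).1 - x.1)| ≤ K * |x.2| * |y.1 - x.1| := by
      intro n
      have hseg := hG.convex.segment_subset hx hy
      have hs : ContDiffOn ℝ ∞ (fun x => (G^[n] x).1) Ω := (hG.contDiffOn_iterate n).fst
      refine norm_image_sub_le_of_norm_fderiv_segment_le (φ := fun z => (G^[n] z).1 - z.1)
        (fun z hz => (hs.hasFDerivAt_fderivWithin hΩ (hseg hz)).sub hasFDerivAt_fst)
        fun z hz => ?_
      have hyx : y - x = (y.1 - x.1) • ((1, 0) : ℝ × ℝ) := by ext <;> simp [hxy]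
      have hz2 : z.2 = x.2 := by
        rw [segment_eq_image'] at hz
        obtain ⟨t, -, rfl⟩ := hz
        simp [hxy]
      rw [hyx, map_smul, norm_smul, mul_comm, ← hz2]
      refine mul_le_mul_of_nonneg_right ?_ (norm_nonneg _)
      have h1 := hG.abs_sub_axis_le (b1.1 n) (C := K)
        (fun x hx => by simpa using hK' n x hx) (hseg hz)
      have h2 : ∀ t : ℝ, (t, (0 : ℝ)) ∈ Ω → G^[n] (t, 0) = (t, 0) := fun t ht =>
        Function.iterate_fixed (hG.fixed' ht) n
      have h3 := fderivWithin_axis_eq hΩ hs (c := 1) (fun t ht => by simp [h2 t ht])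
        (hG.axis_mem z (hseg hz))
      simp only [ContinuousLinearMap.coe_fst'] at h1
      rw [h3] at h1
      simpa using h1
    exact le_of_tendsto ((((hfst y hy).sub_const _).sub ((hfst x hx).sub_const _)).abs)
      (Eventually.of_forall key)

end NormallyContracting

end Planar

/-- The points over `(α, β)` at height less than `ε` lying between the lines of slope `± M⁻¹`
through the end points of the interval. -/
def wedge (α β ε M : ℝ) : Set (ℝ × ℝ) :=
  {x | |x.2| < ε ∧ α + M * |x.2| < x.1 ∧ x.1 + M * |x.2| < β}

section Wedge

variable {α β ε M : ℝ}

theorem isOpen_wedge : IsOpen (wedge α β ε M) := by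
  simp only [wedge, ofPred_and]
  exact (isOpen_lt (by fun_prop) (by fun_prop)).inter
    ((isOpen_lt (by fun_prop) (by fun_prop)).inter (isOpen_lt (by fun_prop) (by fun_prop)))

theorem convex_wedge (hM : 0 ≤ M) : Convex ℝ (wedge α β ε M) := by
  rw [convex_iff_forall_pos]
  rintro x ⟨hx1, hx2, hx3⟩ y ⟨hy1, hy2, hy3⟩ a b ha hb hab
  have habs : |a * x.2 + b * y.2| ≤ a * |x.2| + b * |y.2| := by
    refine (abs_add_le _ _).trans ?_
    rw [abs_mul, abs_mul, abs_of_pos ha, abs_of_pos hb]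
  have hMabs := mul_le_mul_of_nonneg_left habs hM
  have hc : ∀ c : ℝ, c = a * c + b * c := fun c => by rw [← add_mul, hab, one_mul]
  refine ⟨?_, ?_, ?_⟩ <;>
    simp only [Prod.snd_add, Prod.smul_snd, smul_eq_mul, Prod.fst_add, Prod.smul_fst]
  · rw [hc ε]
    exact habs.trans_lt (add_lt_add ((mul_lt_mul_iff_right₀ ha).2 hx1)
      ((mul_lt_mul_iff_right₀ hb).2 hy1))
  · have h1 := (mul_lt_mul_iff_right₀ ha).2 hx2
    have h2 := (mul_lt_mul_iff_right₀ hb).2 hy2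
    linarith [hc α]
  · have h1 := (mul_lt_mul_iff_right₀ ha).2 hx3
    have h2 := (mul_lt_mul_iff_right₀ hb).2 hy3
    linarith [hc β]

theorem wedge_subset (hM : 0 ≤ M) : wedge α β ε M ⊆ Icc α β ×ˢ Icc (-ε) ε := by
  rintro x ⟨h1, h2, h3⟩
  have := mul_nonneg hM (abs_nonneg x.2)
  exact ⟨⟨by linarith, by linarith⟩, abs_le.1 h1.le⟩

theorem axis_mem_wedge (hε : 0 < ε) {t : ℝ} (ht : t ∈ Ioo α β) :
    (t, (0 : ℝ)) ∈ wedge α β ε M := by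
  simpa [wedge, hε] using ht

end Wedge

theorem ContDiffOn.geomBound_of_compact {E V : Type*} [NormedAddCommGroup E] [NormedSpace ℝ E]
    [NormedAddCommGroup V] [NormedSpace ℝ V] {f : E → V} {U R Ω : Set E}
    (hf : ContDiffOn ℝ ∞ f U) (hU : IsOpen U) (hR : IsCompact R) (hRU : R ⊆ U) (hΩ : IsOpen Ω)
    (hΩR : Ω ⊆ R) (k : ℕ) : GeomBound Ω k 1 (fun _ => f) := by
  have hΩU := hΩR.trans hRU
  have hbound : ∀ j : ℕ, ∃ C, 0 ≤ C ∧ ∀ x ∈ Ω, ‖iteratedFDerivWithin ℝ j f Ω x‖ ≤ C := fun j => by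
    obtain ⟨C, hC⟩ := hR.exists_bound_of_continuousOn
      ((hf.continuousOn_iteratedFDerivWithin (m := j) (mod_cast le_top) hU.uniqueDiffOn).mono hRU)
    refine ⟨|C|, abs_nonneg _, fun x hx => ?_⟩
    rw [iteratedFDerivWithin_subset hΩU hΩ.uniqueDiffOn hU.uniqueDiffOn
      (hf.of_le (mod_cast le_top)) hx]
    exact (hC x (hΩR hx)).trans (le_abs_self C)
  choose C hC0 hC using hbound
  refine ⟨fun _ => hf.mono hΩU, ∑ j ∈ Finset.range (k + 1), C j,
    Finset.sum_nonneg fun j _ => hC0 j, fun n x hx j hj => ?_⟩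
  rw [one_pow, mul_one]
  exact (hC j x hx).trans
    (Finset.single_le_sum (f := C) (fun j _ => hC0 j) (Finset.mem_range.2 (by omega)))

theorem exists_normallyContracting_wedge {α β r : ℝ} (hr0 : 0 < r) (hr1 : r < 1)
    {U : Set (ℝ × ℝ)} (hU : IsOpen U) (hJU : Icc α β ×ˢ ({0} : Set ℝ) ⊆ U)
    {G : ℝ × ℝ → ℝ × ℝ} (hG : ContDiffOn ℝ ∞ G U)
    (hfix : ∀ τ ∈ Icc α β, G (τ, 0) = (τ, 0))
    (hD : ∀ τ ∈ Icc α β, (fderiv ℝ G (τ, 0) (0, 1)).2 = r) :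
    ∃ ε M q, 0 < ε ∧ 0 ≤ M ∧ wedge α β ε M ⊆ U ∧ NormallyContracting (wedge α β ε M) G q := by
  obtain ⟨q, hrq, hq1⟩ := exists_between hr1
  have hq0 : 0 ≤ q := hr0.le.trans hrq.le
  have hcont : ContinuousOn (fderiv ℝ G) U :=
    hG.continuousOn_fderiv_of_isOpen hU (mod_cast le_top)
  have hcont' : ContinuousOn (fun x => |(fderiv ℝ G x (0, 1)).2|) U := by fun_prop
  have hO : IsOpen (U ∩ (fun x => |(fderiv ℝ G x (0, 1)).2|) ⁻¹' Iio q) :=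
    hcont'.isOpen_inter_preimage hU isOpen_Iio
  obtain ⟨δ, hδ, hsub⟩ := (isCompact_Icc.prod isCompact_singleton).exists_thickening_subset_open hO
    (show Icc α β ×ˢ ({0} : Set ℝ) ⊆ _ from fun x hx => ⟨hJU hx, by
      obtain ⟨t, v⟩ := x
      obtain ⟨ht, rfl⟩ := hx
      simpa [hD t ht, abs_of_pos hr0] using hrq⟩)
  have hR : Icc α β ×ˢ Icc (-(δ / 2)) (δ / 2) ⊆
      U ∩ (fun x => |(fderiv ℝ G x (0, 1)).2|) ⁻¹' Iio q := by
    rintro ⟨t, v⟩ ⟨ht, hv⟩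
    refine hsub (Metric.mem_thickening_iff.2 ⟨(t, 0), ⟨ht, rfl⟩, ?_⟩)
    have : |v| ≤ δ / 2 := abs_le.2 hv
    simp only [Prod.dist_eq, dist_self, Real.dist_eq, sub_zero, abs_nonneg, sup_of_le_right]
    linarith
  have hRU := hR.trans inter_subset_left
  have hRc : IsCompact (Icc α β ×ˢ Icc (-(δ / 2)) (δ / 2)) := isCompact_Icc.prod isCompact_Icc
  obtain ⟨C', hC'⟩ := hRc.exists_bound_of_continuousOn (hcont.mono hRU)
  obtain ⟨C, hC0, hC⟩ : ∃ C, 0 ≤ C ∧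
      ∀ x ∈ Icc α β ×ˢ Icc (-(δ / 2)) (δ / 2), ‖fderiv ℝ G x‖ ≤ C :=
    ⟨|C'|, abs_nonneg _, fun x hx => (hC' x hx).trans (le_abs_self _)⟩
  have hCM : ∀ M, M = (C + 1) / (1 - q) → 0 ≤ M ∧ C + M * q ≤ M := by
    rintro M rfl
    have h1 : 0 < 1 - q := by linarith
    refine ⟨by positivity, ?_⟩
    have : (C + 1) / (1 - q) * (1 - q) = C + 1 := div_mul_cancel₀ _ h1.ne'
    linarith
  obtain ⟨hM0, hMC⟩ := hCM _ rfl
  set M := (C + 1) / (1 - q)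
  have hΩR : wedge α β (δ / 2) M ⊆ _ := wedge_subset hM0
  have hax : ∀ x ∈ wedge α β (δ / 2) M, x.1 ∈ Ioo α β := fun x ⟨_, h2, h3⟩ => by
    have := mul_nonneg hM0 (abs_nonneg x.2)
    exact ⟨by linarith, by linarith⟩
  have hdG : ∀ x ∈ Icc α β ×ˢ Icc (-(δ / 2)) (δ / 2), HasFDerivAt G (fderiv ℝ G x) x :=
    fun x hx => ((hG.contDiffAt (hU.mem_nhds (hRU hx))).differentiableAt (by simp)).hasFDerivAt
  have hmap : ∀ x ∈ wedge α β (δ / 2) M, |(G x).1 - x.1| ≤ C * |x.2| ∧ |(G x).2| ≤ q * |x.2| := by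
    intro x hx
    have hseg : segment ℝ (x.1, 0) x ⊆ Icc α β ×ˢ Icc (-(δ / 2)) (δ / 2) :=
      ((convex_wedge hM0).segment_subset (axis_mem_wedge (half_pos hδ) (hax x hx)) hx).trans hΩR
    have hsub : x - (x.1, 0) = x.2 • ((0, 1) : ℝ × ℝ) := by ext <;> simp
    have hf := hfix x.1 (Ioo_subset_Icc_self (hax x hx))
    constructor
    · have := norm_image_sub_le_of_norm_fderiv_segment_le (C := C * |x.2|)
        (fun z hz => (hdG z (hseg hz))) (fun z hz => by
          refine ((fderiv ℝ G z).le_opNorm _).trans ?_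
          refine mul_le_mul (hC z (hseg hz)) ?_ (norm_nonneg _) hC0
          simp [hsub, Prod.norm_def])
      rw [hf] at this
      simpa using (norm_fst_le _).trans this
    · have := norm_image_sub_le_of_norm_fderiv_segment_le (C := q * |x.2|)
        (fun z hz => (hdG z (hseg hz)).snd) (fun z hz => by
          have := (hR (hseg hz)).2
          simp only [mem_preimage, mem_Iio] at this
          rw [hsub, map_smul, norm_smul, mul_comm]
          exact mul_le_mul_of_nonneg_right this.le (norm_nonneg _))
      rw [hf] at this
      simpa using this
  refine ⟨δ / 2, M, q, half_pos hδ, hM0, hΩR.trans hRU, isOpen_wedge, convex_wedge hM0, ?_,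
    hG.geomBound_of_compact hU hRc hRU isOpen_wedge hΩR,
    contDiff_id.contDiffOn.geomBound_of_compact hU hRc hRU isOpen_wedge hΩR,
    fun x hx => axis_mem_wedge (half_pos hδ) (hax x hx),
    fun x hx => hfix _ (Ioo_subset_Icc_self (hax x hx)), hq0, hq1, ?_⟩
  · intro x hx
    obtain ⟨h1, h2⟩ := hmap x hx
    obtain ⟨hx1, hx2, hx3⟩ := hx
    have h3 := mul_le_mul_of_nonneg_left h2 hM0
    have h4 := mul_le_mul_of_nonneg_right hMC (abs_nonneg x.2)
    have h5 := mul_le_mul_of_nonneg_right hq1.le (abs_nonneg x.2)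
    obtain ⟨h6, h7⟩ := abs_le.1 h1
    exact ⟨by linarith, by linarith, by linarith⟩
  · intro x hx
    rw [fderivWithin_of_isOpen isOpen_wedge hx]
    exact (hR (hΩR hx)).2.le

section Chart

variable {Ω D : Set (ℝ × ℝ)} {h : ℝ × ℝ → ℝ} {K : ℝ}

theorem fderiv_fst_ne_zero (hΩ : IsOpen Ω) (hh : ContDiffOn ℝ ∞ h Ω)
    (hK : ∀ x ∈ Ω, ∀ y ∈ Ω, x.2 = y.2 →
      |(h y - y.1) - (h x - x.1)| ≤ K * |x.2| * |y.1 - x.1|)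
    {x : ℝ × ℝ} (hx : x ∈ Ω) (hxK : K * |x.2| ≤ 1 / 2) : fderiv ℝ h x (1, 0) ≠ 0 := by
  have hd : HasFDerivAt h (fderiv ℝ h x) x :=
    ((hh.contDiffAt (hΩ.mem_nhds hx)).differentiableAt (by simp)).hasFDerivAt
  have h1 : HasDerivAt (fun s : ℝ => (s, x.2)) ((1 : ℝ), (0 : ℝ)) x.1 :=
    (hasDerivAt_id x.1).prodMk (hasDerivAt_const x.1 x.2)
  have h2 : HasDerivAt (fun s : ℝ => h (s, x.2) - s) (fderiv ℝ h x (1, 0) - 1) x.1 :=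
    (hd.comp_hasDerivAt x.1 h1).sub (hasDerivAt_id x.1)
  have h3 := h2.hasFDerivAt.le_of_lip' (C := 1 / 2) (by norm_num) (by
    filter_upwards [h1.continuousAt.preimage_mem_nhds (hΩ.mem_nhds hx)] with s hs
    refine (hK x hx (s, x.2) hs rfl).trans ?_
    exact mul_le_mul_of_nonneg_right hxK (abs_nonneg _))
  intro h0
  rw [h0] at h3
  norm_num at h3

/-- The map `x ↦ (h x, x.2)` has a smooth inverse over a domain contained in its image, provided
`h` is close to the first coordinate. -/
theorem exists_phase_chart (hΩ : IsOpen Ω) (hD : IsOpen D) (hh : ContDiffOn ℝ ∞ h Ω)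
    (hK : ∀ x ∈ Ω, ∀ y ∈ Ω, x.2 = y.2 →
      |(h y - y.1) - (h x - x.1)| ≤ K * |x.2| * |y.1 - x.1|)
    (hDK : ∀ p ∈ D, K * |p.2| ≤ 1 / 2)
    (hsurj : ∀ p ∈ D, ∃ a : ℝ, (a, p.2) ∈ Ω ∧ h (a, p.2) = p.1) :
    ∃ Λ : ℝ × ℝ → ℝ × ℝ, ContDiffOn ℝ ∞ Λ D ∧
      (∀ p ∈ D, Λ p ∈ Ω ∧ h (Λ p) = p.1 ∧ (Λ p).2 = p.2) ∧
      ∀ x ∈ Ω, (h x, x.2) ∈ D → Λ (h x, x.2) = x := by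
  choose! a ha hha using hsurj
  have hinj : ∀ x ∈ Ω, ∀ y ∈ Ω, K * |x.2| ≤ 1 / 2 → x.2 = y.2 → h x = h y → x = y := by
    intro x hx y hy hxK hxy hhxy
    have h1 := hK x hx y hy hxy
    have h2 := h1.trans (mul_le_mul_of_nonneg_right hxK (abs_nonneg (y.1 - x.1)))
    rw [show h y - y.1 - (h x - x.1) = -(y.1 - x.1) by rw [hhxy]; ring, abs_neg] at h2
    have h3 : |y.1 - x.1| = 0 := le_antisymm (by linarith) (abs_nonneg _)
    exact Prod.ext (by linarith [abs_eq_zero.1 h3]) hxy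
  refine ⟨fun p => (a p, p.2), fun p hp => ContDiffAt.contDiffWithinAt ?_,
    fun p hp => ⟨ha p hp, hha p hp, rfl⟩,
    fun x hx hxD => hinj _ (ha _ hxD) x hx (hDK (h x, x.2) hxD) rfl (hha _ hxD)⟩
  have hat : ContDiffAt ℝ ∞ h (a p, p.2) := hh.contDiffAt (hΩ.mem_nhds (ha p hp))
  have hne := fderiv_fst_ne_zero hΩ hh hK (ha p hp) (hDK p hp)
  set η := fderiv ℝ h (a p, p.2)
  set T : ℝ × ℝ →L[ℝ] ℝ × ℝ := η.prod (ContinuousLinearMap.snd ℝ ℝ ℝ)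
  have hTinj : Function.Injective T := by
    refine (injective_iff_map_eq_zero T).2 fun z hz => ?_
    have hz2 : z.2 = 0 := congrArg Prod.snd hz
    have hz1 : η z = 0 := congrArg Prod.fst hz
    rw [show z = z.1 • ((1, 0) : ℝ × ℝ) by ext <;> simp [hz2], map_smul, smul_eq_mul] at hz1
    exact Prod.ext ((mul_eq_zero.1 hz1).resolve_right hne) hz2
  let e : (ℝ × ℝ) ≃L[ℝ] ℝ × ℝ :=
    (LinearEquiv.ofInjectiveEndo (T : ℝ × ℝ →ₗ[ℝ] ℝ × ℝ) hTinj).toContinuousLinearEquiv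
  have he : (e : ℝ × ℝ →L[ℝ] ℝ × ℝ) = T := by
    ext <;> rfl
  have hΘ : ContDiffAt ℝ ∞ (fun x : ℝ × ℝ => (h x, x.2)) (a p, p.2) :=
    hat.prodMk contDiffAt_snd
  have hΘ' : HasFDerivAt (fun x : ℝ × ℝ => (h x, x.2)) (e : ℝ × ℝ →L[ℝ] ℝ × ℝ) (a p, p.2) := by
    rw [he]
    exact (hat.differentiableAt (by simp)).hasFDerivAt.prodMk hasFDerivAt_snd
  have hn : (∞ : WithTop ℕ∞) ≠ 0 := by simp
  have hs := hΘ.hasStrictFDerivAt' hΘ' hn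
  have himg : ((fun x : ℝ × ℝ => (h x, x.2)) (a p, p.2)) = p := by
    simp [hha p hp]
  have hloc := hΘ.to_localInverse hΘ' hn
  have hr := hs.eventually_right_inverse
  have ht := hs.localInverse_tendsto
  simp only [himg] at hloc hr ht
  refine hloc.congr_of_eventuallyEq ?_
  filter_upwards [hr, ht.eventually (hΩ.mem_nhds (ha p hp)), hD.mem_nhds hp] with y hy hyΩ hyD
  exact hinj _ (ha y hyD) _ hyΩ (hDK y hyD) (congrArg Prod.snd hy).symm
    ((hha y hyD).trans (congrArg Prod.fst hy).symm)

end Chart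

/-- A smooth positive height function on `(α, β)` vanishing at the end points, with small slope. -/
theorem exists_smooth_height {α β ε M K : ℝ} (hε : 0 < ε) (hM : 0 ≤ M) (hK : 0 ≤ K)
    (hαβ : α < β) :
    ∃ δ : ℝ → ℝ, ContDiff ℝ ∞ δ ∧ ∀ τ ∈ Ioo α β, 0 < δ τ ∧ ∀ v : ℝ, |v| < 2 * δ τ →
      |v| < ε ∧ α + M * |v| < τ ∧ τ + M * |v| < β ∧ K * |v| ≤ 1 / 2 := by
  obtain ⟨c, hc0, hc⟩ : ∃ c, 0 < c ∧ 2 * c * (β - α) ^ 2 ≤ ε ∧ M * (2 * c * (β - α)) < 1 ∧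
      K * (2 * c * (β - α) ^ 2) ≤ 1 / 2 := by
    have hl : 0 < β - α := sub_pos.2 hαβ
    have h1 : ∀ᶠ c in 𝓝[>] (0 : ℝ), 2 * c * (β - α) ^ 2 < ε := by
      refine nhdsWithin_le_nhds (ContinuousAt.eventually_lt (by fun_prop) (by fun_prop) ?_)
      simpa using hε
    have h2 : ∀ᶠ c in 𝓝[>] (0 : ℝ), M * (2 * c * (β - α)) < 1 := by
      refine nhdsWithin_le_nhds (ContinuousAt.eventually_lt (by fun_prop) (by fun_prop) ?_)
      simp
    have h3 : ∀ᶠ c in 𝓝[>] (0 : ℝ), K * (2 * c * (β - α) ^ 2) < 1 / 2 := by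
      refine nhdsWithin_le_nhds (ContinuousAt.eventually_lt (by fun_prop) (by fun_prop) ?_)
      simp
    obtain ⟨c, ⟨h1, h2, h3⟩, h0⟩ := ((h1.and (h2.and h3)).and self_mem_nhdsWithin).exists
    exact ⟨c, h0, h1.le, h2, h3.le⟩
  obtain ⟨h1, h2, h3⟩ := hc
  refine ⟨fun τ => c * (τ - α) * (β - τ), by fun_prop, fun τ ⟨hα, hβ⟩ => ?_⟩
  have ha : 0 < τ - α := sub_pos.2 hα
  have hb : 0 < β - τ := sub_pos.2 hβ
  refine ⟨by positivity, fun v hv => ?_⟩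
  have hle : 2 * (c * (τ - α) * (β - τ)) ≤ 2 * c * (β - α) ^ 2 := by
    have : (τ - α) * (β - τ) ≤ (β - α) * (β - α) :=
      mul_le_mul (by linarith) (by linarith) hb.le (by linarith)
    nlinarith
  have hla : M * (2 * (c * (τ - α) * (β - τ))) < τ - α := by
    have : M * (2 * c * (β - τ)) < 1 := (mul_le_mul_of_nonneg_left
      (mul_le_mul_of_nonneg_left (by linarith) (by positivity)) hM).trans_lt h2
    nlinarith
  have hlb : M * (2 * (c * (τ - α) * (β - τ))) < β - τ := by
    have : M * (2 * c * (τ - α)) < 1 := (mul_le_mul_of_nonneg_left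
      (mul_le_mul_of_nonneg_left (by linarith) (by positivity)) hM).trans_lt h2
    nlinarith
  have hMv := mul_le_mul_of_nonneg_left hv.le hM
  have hKv := mul_le_mul_of_nonneg_left (hv.le.trans hle) hK
  exact ⟨by linarith, by linarith, by linarith, by linarith⟩

theorem ContDiffOn.exists_contDiff_eqOn {V : Type*} [NormedAddCommGroup V] [NormedSpace ℝ V]
    {f : ℝ → V} (hf : ContDiffOn ℝ ∞ f (Ioo (-2) 2)) :
    ∃ c : ℝ → V, ContDiff ℝ ∞ c ∧ EqOn c f (Ioo (-1) 1) := by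
  let χ : ContDiffBump (0 : ℝ) := ⟨1, 3 / 2, one_pos, by norm_num⟩
  refine ⟨fun s => χ s • f s, contDiff_iff_contDiffAt.2 fun s => ?_, fun s hs => ?_⟩
  · by_cases hs : |s| < 2
    · exact χ.contDiffAt.smul (hf.contDiffAt (isOpen_Ioo.mem_nhds (abs_lt.1 hs)))
    · refine contDiffAt_const (c := (0 : V)) |>.congr_of_eventuallyEq ?_
      have : ∀ᶠ t in 𝓝 s, 3 / 2 < |t| :=
        continuous_abs.continuousAt.eventually_const_lt (by linarith [not_lt.1 hs])
      filter_upwards [this] with t ht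
      rw [χ.zero_of_le_dist (by simpa [Real.dist_eq] using ht.le), zero_smul]
  · have : χ s = 1 := χ.one_of_mem_closedBall (by
      simpa [Real.dist_eq, abs_le] using ⟨hs.1.le, hs.2.le⟩)
    simp [this]

/-- A tangent vector annihilated by the differential of an invariant phase function spans the
contracted eigendirection of the derivative. -/
theorem eq_smul_of_phase_eq_zero {b r : ℝ} (hr1 : r < 1) {L : ℝ × ℝ →L[ℝ] ℝ × ℝ}
    (hL : ∀ p : ℝ × ℝ, L p = (p.1 + b * p.2, r * p.2)) {η : ℝ × ℝ →L[ℝ] ℝ} (h1 : η (1, 0) = 1)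
    (hη : η.comp L = η) {w : ℝ × ℝ} (hw : η w = 0) :
    w = (w.2 / (1 - r)) • ((-b, 1 - r) : ℝ × ℝ) := by
  have hform : ∀ p : ℝ × ℝ, η p = p.1 + p.2 * η (0, 1) := fun p => by
    have hp : p = p.1 • ((1, 0) : ℝ × ℝ) + p.2 • ((0, 1) : ℝ × ℝ) := by ext <;> simp
    conv_lhs => rw [hp]
    rw [map_add, map_smul, map_smul, h1, smul_eq_mul, smul_eq_mul, mul_one]
  have h2 := DFunLike.congr_fun hη (0, 1)
  rw [ContinuousLinearMap.comp_apply, hform, hL] at h2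
  rw [hform] at hw
  have hr : 1 - r ≠ 0 := (sub_pos.2 hr1).ne'
  ext
  · simp only [Prod.smul_fst, smul_eq_mul]
    field_simp
    linear_combination (1 - r) * hw + w.2 * h2
  · simp only [Prod.smul_snd, smul_eq_mul]
    field_simp

/-- **Nondegenerate chatter: smooth foliation by stable manifolds (Takens).**
Under the same hypotheses as the continuous-foliation theorem, the neighbourhood
`U'` and the stable manifolds `W τ` can be chosen so that the trivialising map
`Φ : (α,β) × (−1,1) → U'` (with `Φ(τ,0) = (τ,0)` and `Φ({τ} × (−1,1)) = W τ`) is a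
`C^∞` diffeomorphism; in particular the stable manifolds form a smooth foliation
of `U'` and vary smoothly with `τ`. -/
theorem nondegenerate_chatter_smooth_foliation
    (α β r : ℝ) (hαβ : α < β) (hr0 : 0 < r) (hr1 : r < 1)
    (U : Set (ℝ × ℝ)) (hUopen : IsOpen U)
    (hJU : Set.Icc α β ×ˢ ({0} : Set ℝ) ⊆ U)
    (G : ℝ × ℝ → ℝ × ℝ) (hGsmooth : ContDiffOn ℝ (⊤ : ℕ∞) G U)
    (b : ℝ → ℝ) (hb : ContinuousOn b (Set.Icc α β))
    (hfix : ∀ τ ∈ Set.Icc α β, G (τ, 0) = (τ, 0))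
    (L : ℝ → (ℝ × ℝ) →L[ℝ] ℝ × ℝ)
    (hLdef : ∀ τ : ℝ, ∀ p : ℝ × ℝ, L τ p = (p.1 + b τ * p.2, r * p.2))
    (hD : ∀ τ ∈ Set.Icc α β, HasFDerivAt G (L τ) ((τ, 0) : ℝ × ℝ)) :
    ∃ U' : Set (ℝ × ℝ), IsOpen U' ∧ U' ⊆ U ∧
      Set.Ioo α β ×ˢ ({0} : Set ℝ) ⊆ U' ∧
      ∃ W : ℝ → Set (ℝ × ℝ),
        (∀ τ ∈ Set.Ioo α β,
          (τ, 0) ∈ W τ ∧ W τ ⊆ U' ∧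
          -- (i) W τ is the image of a C¹ embedding of an open interval, passing
          -- through (τ,0) with tangent direction (−b(τ), 1 − r) there
          (∃ c : ℝ → ℝ × ℝ, ContDiff ℝ 1 c ∧
            Set.InjOn c (Set.Ioo (-1 : ℝ) 1) ∧
            (∀ s ∈ Set.Ioo (-1 : ℝ) 1, deriv c s ≠ 0) ∧
            c '' Set.Ioo (-1 : ℝ) 1 = W τ ∧ c 0 = (τ, 0) ∧
            (∃ k : ℝ, k ≠ 0 ∧ deriv c 0 = k • ((-b τ, 1 - r) : ℝ × ℝ))) ∧
          -- (ii) invariance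
          G '' (W τ ∩ G ⁻¹' U') ⊆ W τ ∧
          -- (iii) stable-manifold characterisation
          W τ = {u ∈ U' | (∀ n : ℕ, G^[n] u ∈ U') ∧
            Filter.Tendsto (fun n => G^[n] u) Filter.atTop (nhds ((τ, 0) : ℝ × ℝ))}) ∧
        -- (iv) continuous trivialisation Φ : (α,β) × (−1,1) → U'
        ∃ Φ Ψ : ℝ × ℝ → ℝ × ℝ,
          ContDiffOn ℝ (⊤ : ℕ∞) Φ (Set.Ioo α β ×ˢ Set.Ioo (-1 : ℝ) 1) ∧
          ContDiffOn ℝ (⊤ : ℕ∞) Ψ U' ∧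
          Set.BijOn Φ (Set.Ioo α β ×ˢ Set.Ioo (-1 : ℝ) 1) U' ∧
          Set.InvOn Ψ Φ (Set.Ioo α β ×ˢ Set.Ioo (-1 : ℝ) 1) U' ∧
          (∀ τ ∈ Set.Ioo α β, Φ (τ, 0) = (τ, 0)) ∧
          (∀ τ ∈ Set.Ioo α β, Φ '' ({τ} ×ˢ Set.Ioo (-1 : ℝ) 1) = W τ) := by
  have hderiv : ∀ τ ∈ Icc α β, (fderiv ℝ G (τ, 0) (0, 1)).2 = r := fun τ hτ => by
    rw [(hD τ hτ).fderiv, hLdef]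
    simp
  obtain ⟨ε, M, q, hε, hM, hΩU, hG⟩ :=
    exists_normallyContracting_wedge hr0 hr1 hUopen hJU hGsmooth hfix hderiv
  set Ω := wedge α β ε M
  obtain ⟨h, hh, hlim, ⟨M₁, hM₁, hhM⟩, K, hK0, hK⟩ := hG.exists_asymptotic_phase
  obtain ⟨δ, hδ, hheight⟩ := exists_smooth_height (M := M + M₁) hε (add_nonneg hM hM₁) hK0 hαβ
  have hax : ∀ τ ∈ Ioo α β, (τ, (0 : ℝ)) ∈ Ω := fun τ hτ => axis_mem_wedge hε hτ
  have hh0 : ∀ τ : ℝ, (τ, (0 : ℝ)) ∈ Ω → h (τ, 0) = τ := fun τ hτ => by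
    simpa [sub_eq_zero] using hhM _ hτ
  have hhG : ∀ x ∈ Ω, h (G x) = h x := fun x hx => by
    have h1 := (tendsto_add_atTop_iff_nat 1).2 (hlim x hx)
    exact congrArg Prod.fst (tendsto_nhds_unique (hlim _ (hG.mapsTo hx)) h1)
  have hδc := hδ.continuous
  have hopen : ∀ m : ℝ, IsOpen {p : ℝ × ℝ | p.1 ∈ Ioo α β ∧ |p.2| < m * δ p.1} := fun m =>
    (isOpen_Ioo.preimage continuous_fst).inter
      (isOpen_lt (f := fun p : ℝ × ℝ => |p.2|) (by fun_prop) (by fun_prop))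
  obtain ⟨Λ, hΛ, hΛmem, hΛinv⟩ := exists_phase_chart hG.isOpen (hopen 2) hh hK
    (fun p hp => ((hheight p.1 hp.1).2 p.2 hp.2).2.2.2) (fun p hp => by
      obtain ⟨h1, h2, h3, -⟩ := (hheight p.1 hp.1).2 p.2 hp.2
      have hle : 0 ≤ M₁ * |p.2| := mul_nonneg hM₁ (abs_nonneg _)
      have hmem : ∀ a ∈ Icc (p.1 - M₁ * |p.2|) (p.1 + M₁ * |p.2|), (a, p.2) ∈ Ω :=
        fun a ha => ⟨h1, by simp only; linarith [ha.1], by simp only; linarith [ha.2]⟩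
      have hcont : ContinuousOn (fun a => h (a, p.2))
          (Icc (p.1 - M₁ * |p.2|) (p.1 + M₁ * |p.2|)) :=
        hh.continuousOn.comp (by fun_prop) hmem
      have hlow := hhM _ (hmem _ (left_mem_Icc.2 (by linarith)))
      have hupp := hhM _ (hmem _ (right_mem_Icc.2 (by linarith)))
      obtain ⟨a, ha, hap⟩ := intermediate_value_Icc (by linarith) hcont
        (show p.1 ∈ _ from ⟨by linarith [(abs_le.1 hlow).2], by linarith [(abs_le.1 hupp).1]⟩)
      exact ⟨a, hmem a ha, hap⟩)
  set U' : Set (ℝ × ℝ) :=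
    Ω ∩ (fun x => (h x, x.2)) ⁻¹' {p | p.1 ∈ Ioo α β ∧ |p.2| < 1 * δ p.1}
  set Φ : ℝ × ℝ → ℝ × ℝ := fun p => Λ (p.1, δ p.1 * p.2) with hΦ
  have hU'G : MapsTo G U' U' := fun x hx => by
    refine ⟨hG.mapsTo hx.1, ?_⟩
    have h1 := hG.abs_snd_le hx.1
    have h2 := mul_le_mul_of_nonneg_right hG.lt_one.le (abs_nonneg x.2)
    simp only [mem_preimage, hhG x hx.1]
    exact ⟨hx.2.1, lt_of_le_of_lt (by linarith) hx.2.2⟩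
  have hD2 : MapsTo (fun p : ℝ × ℝ => (p.1, δ p.1 * p.2)) (Ioo α β ×ˢ Ioo (-2) 2)
      {p | p.1 ∈ Ioo α β ∧ |p.2| < 2 * δ p.1} := fun p hp => by
    have := (hheight p.1 hp.1).1
    refine ⟨hp.1, ?_⟩
    simp only [abs_mul, abs_of_pos this]
    rw [mul_comm]
    exact mul_lt_mul_of_pos_right (abs_lt.2 hp.2) this
  have hΦsmooth : ContDiffOn ℝ ∞ Φ (Ioo α β ×ˢ Ioo (-2) 2) :=
    hΛ.comp (by fun_prop) hD2
  have hsub : Ioo α β ×ˢ Ioo (-1 : ℝ) 1 ⊆ Ioo α β ×ˢ Ioo (-2) 2 :=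
    prod_mono_right (Ioo_subset_Ioo (by norm_num) (by norm_num))
  have hΦh : ∀ p ∈ Ioo α β ×ˢ Ioo (-1 : ℝ) 1, h (Φ p) = p.1 := fun p hp =>
    (hΛmem _ (hD2 (hsub hp))).2.1
  have hΦ2 : ∀ p ∈ Ioo α β ×ˢ Ioo (-1 : ℝ) 1, (Φ p).2 = δ p.1 * p.2 := fun p hp =>
    (hΛmem _ (hD2 (hsub hp))).2.2
  have hΦmaps : MapsTo Φ (Ioo α β ×ˢ Ioo (-1 : ℝ) 1) U' := fun p hp => by
    have := (hheight p.1 hp.1).1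
    refine ⟨(hΛmem _ (hD2 (hsub hp))).1, ?_⟩
    simp only [mem_preimage, hΦh p hp, hΦ2 p hp]
    refine ⟨hp.1, ?_⟩
    simp only [abs_mul, abs_of_pos this]
    rw [mul_comm]
    exact mul_lt_mul_of_pos_right (abs_lt.2 hp.2) this
  have hpos : ∀ x ∈ U', 0 < δ (h x) := fun x hx => (hheight _ hx.2.1).1
  have hΨmaps : MapsTo (fun x => (h x, x.2 / δ (h x))) U' (Ioo α β ×ˢ Ioo (-1 : ℝ) 1) :=
    fun x hx => by
      have h1 := hpos x hx
      have h2 : |x.2| < 1 * δ (h x) := hx.2.2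
      refine ⟨hx.2.1, abs_lt.1 ?_⟩
      rw [abs_div, abs_of_pos h1, div_lt_iff₀ h1]
      exact h2
  have hinv : InvOn (fun x => (h x, x.2 / δ (h x))) Φ (Ioo α β ×ˢ Ioo (-1 : ℝ) 1) U' := by
    refine ⟨fun p hp => ?_, fun x hx => ?_⟩
    · have := (hheight p.1 hp.1).1
      simp only [hΦh p hp, hΦ2 p hp]
      rw [mul_div_cancel_left₀ _ this.ne']
    · have h1 := hpos x hx
      have h2 : |x.2| < 1 * δ (h x) := hx.2.2
      simp only [hΦ]
      rw [mul_div_cancel₀ _ h1.ne']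
      exact hΛinv x hx.1 ⟨hx.2.1, by simp only; linarith⟩
  have hbij := hinv.bijOn hΦmaps hΨmaps
  have hU'ax : ∀ τ ∈ Ioo α β, (τ, (0 : ℝ)) ∈ U' := fun τ hτ => by
    refine ⟨hax τ hτ, ?_⟩
    simpa [hh0 τ (hax τ hτ), (hheight τ hτ).1] using hτ
  have hΦ0 : ∀ τ ∈ Ioo α β, Φ (τ, 0) = (τ, 0) := fun τ hτ => by
    simpa [hh0 τ (hax τ hτ)] using hinv.2 (hU'ax τ hτ)
  have hΦW : ∀ τ ∈ Ioo α β, Φ '' ({τ} ×ˢ Ioo (-1 : ℝ) 1) = {u ∈ U' | h u = τ} := by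
    intro τ hτ
    ext x
    constructor
    · rintro ⟨⟨t, s⟩, ⟨rfl, hs⟩, rfl⟩
      exact ⟨hΦmaps ⟨hτ, hs⟩, hΦh _ ⟨hτ, hs⟩⟩
    · rintro ⟨hx, rfl⟩
      exact ⟨_, ⟨mem_singleton _, (hΨmaps hx).2⟩, hinv.2 hx⟩
  refine ⟨U', ?_, fun x hx => hΩU hx.1, ?_, fun τ => {u ∈ U' | h u = τ}, fun τ hτ => ?_, Φ, _,
    hΦsmooth.mono hsub, ?_, hbij, hinv, hΦ0, hΦW⟩
  · exact (hh.continuousOn.prodMk continuousOn_snd).isOpen_inter_preimage hG.isOpen (hopen 1)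
  · rintro ⟨τ, v⟩ ⟨hτ, rfl⟩
    exact hU'ax τ hτ
  · refine ⟨⟨hU'ax τ hτ, hh0 τ (hax τ hτ)⟩, fun u hu => hu.1, ?_, ?_, ?_⟩
    · obtain ⟨c, hc, hcΦ⟩ := ContDiffOn.exists_contDiff_eqOn (f := fun s => Φ (τ, s))
        (hΦsmooth.comp (by fun_prop) fun s hs => ⟨hτ, hs⟩)
      have hmem : ∀ s ∈ Ioo (-1 : ℝ) 1, (τ, s) ∈ Ioo α β ×ˢ Ioo (-1 : ℝ) 1 :=
        fun s hs => ⟨hτ, hs⟩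
      have hcd : ∀ s, HasDerivAt c (deriv c s) s := fun s =>
        (hc.differentiable (by simp) s).hasDerivAt
      have hc2 : ∀ s ∈ Ioo (-1 : ℝ) 1, (deriv c s).2 = δ τ := fun s hs => by
        have h1 : HasDerivAt (fun s => δ τ * s) (δ τ) s := by
          simpa using (hasDerivAt_id s).const_mul (δ τ)
        have h2 : HasDerivAt (fun s => (c s).2) (deriv c s).2 s :=
          (ContinuousLinearMap.snd ℝ ℝ ℝ).hasFDerivAt.comp_hasDerivAt s (hcd s)
        refine h2.unique (h1.congr_of_eventuallyEq ?_)
        filter_upwards [isOpen_Ioo.mem_nhds hs] with t ht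
        rw [hcΦ ht]
        exact hΦ2 _ (hmem t ht)
      have hz : (0 : ℝ) ∈ Ioo (-1 : ℝ) 1 := by norm_num
      have hδτ := (hheight τ hτ).1
      have hc0 : c 0 = (τ, 0) := (hcΦ hz).trans (hΦ0 τ hτ)
      refine ⟨c, hc.of_le (mod_cast le_top), ?_, fun s hs hs0 => ?_, ?_, hc0,
        δ τ / (1 - r), ?_, ?_⟩
      · intro s hs t ht hst
        rw [hcΦ hs, hcΦ ht] at hst
        exact congrArg Prod.snd (hbij.injOn (hmem s hs) (hmem t ht) hst)
      · have := hc2 s hs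
        rw [hs0] at this
        exact hδτ.ne this
      · change c '' Ioo (-1 : ℝ) 1 = {u ∈ U' | h u = τ}
        rw [image_congr hcΦ, ← hΦW τ hτ, singleton_prod, image_image]
      · exact (div_pos hδτ (sub_pos.2 hr1)).ne'
      · have hη := hh.hasFDerivAt_fderivWithin hG.isOpen (hax τ hτ)
        have hηL : (fderivWithin ℝ h Ω (τ, 0)).comp (L τ) = fderivWithin ℝ h Ω (τ, 0) := by
          have hτ' := hD τ (Ioo_subset_Icc_self hτ)
          have hη' := hη
          rw [← hfix τ (Ioo_subset_Icc_self hτ)] at hη'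
          have hcomp := hη'.comp (τ, 0) hτ'
          rw [hfix τ (Ioo_subset_Icc_self hτ)] at hcomp
          refine hcomp.unique (hη.congr_of_eventuallyEq ?_)
          filter_upwards [hG.isOpen.mem_nhds (hax τ hτ)] with x hx using hhG x hx
        have hηc : fderivWithin ℝ h Ω (τ, 0) (deriv c 0) = 0 := by
          rw [← hc0] at hη
          have hcomp := hη.comp_hasDerivAt 0 (hcd 0)
          rw [hc0] at hcomp
          refine hcomp.unique ((hasDerivAt_const (0 : ℝ) τ).congr_of_eventuallyEq ?_)
          filter_upwards [isOpen_Ioo.mem_nhds hz] with t ht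
          rw [Function.comp_apply, hcΦ ht]
          exact hΦh _ (hmem t ht)
        have hη1 := fderivWithin_axis_eq (c := 1) hG.isOpen hh
          (fun t ht => by rw [hh0 t ht, one_mul]) (hax τ hτ)
        have := eq_smul_of_phase_eq_zero hr1 (hLdef τ) hη1 hηL hηc
        rwa [hc2 0 hz] at this
    · rintro _ ⟨u, ⟨⟨hu, hτu⟩, -⟩, rfl⟩
      exact ⟨hU'G hu, (hhG u hu.1).trans hτu⟩
    · ext u
      constructor
      · rintro ⟨hu, rfl⟩
        exact ⟨hu, fun n => hU'G.iterate n hu, hlim u hu.1⟩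
      · rintro ⟨hu, -, hut⟩
        exact ⟨hu, congrArg Prod.fst (tendsto_nhds_unique (hlim u hu.1) hut)⟩
  · have hhU : ContDiffOn ℝ ∞ h U' := hh.mono inter_subset_left
    exact hhU.prodMk (contDiff_snd.contDiffOn.div (hδ.comp_contDiffOn hhU)
      fun x hx => (hpos x hx).ne')
end
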